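/- arXiv:1703.04950 — 2 statements merged into one kernel-verified Lean document; each statement's English description precedes it below -/
import Mathlib

section
/- The only solution of x^2 + 5^a·11^b = y^6 in positive integers x, y with gcd(x,y)=1 and nonnegative integers a, b is (a,b,x,y) = (1,1,3,2). -/
/-- Decides whether `t` is congruent modulo `m` to twice a cube. -/
def isTwiceCubeMod (m t : ℕ) : Bool :=
  (List.range m).any fun y => 2 * y ^ 3 % m == t % m

theorem isTwiceCubeMod_of_modEq {m t y : ℕ} (hm : 0 < m) (h : 2 * y ^ 3 ≡ t [MOD m]) :
    isTwiceCubeMod m t = true := by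
  simp only [isTwiceCubeMod, List.any_eq_true, List.mem_range, beq_iff_eq]
  exact ⟨y % m, Nat.mod_lt _ hm, (((Nat.mod_modEq y m).pow 3).mul_left 2).trans h⟩

theorem pow_modEq_pow_mod {c M m : ℕ} (h : c ^ M ≡ 1 [MOD m]) (n : ℕ) :
    c ^ n ≡ c ^ (n % M) [MOD m] := by
  conv_lhs => rw [← Nat.mod_add_div n M, pow_add, pow_mul]
  simpa using ((h.pow (n / M)).mul_left (c ^ (n % M)))

theorem isTwiceCubeMod_one_add {y a b m : ℕ} (M : ℕ) (hm : 0 < m)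
    (h5 : 5 ^ M ≡ 1 [MOD m]) (h11 : 11 ^ M ≡ 1 [MOD m]) (h : 2 * y ^ 3 = 1 + 5 ^ a * 11 ^ b) :
    isTwiceCubeMod m (1 + 5 ^ (a % M) * 11 ^ (b % M)) = true :=
  isTwiceCubeMod_of_modEq hm
    (h ▸ ((pow_modEq_pow_mod h5 a).mul (pow_modEq_pow_mod h11 b)).add_left 1)

theorem isTwiceCubeMod_add {y a b m : ℕ} (M : ℕ) (hm : 0 < m)
    (h5 : 5 ^ M ≡ 1 [MOD m]) (h11 : 11 ^ M ≡ 1 [MOD m]) (h : 2 * y ^ 3 = 5 ^ a + 11 ^ b) :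
    isTwiceCubeMod m (5 ^ (a % M) + 11 ^ (b % M)) = true :=
  isTwiceCubeMod_of_modEq hm
    (h ▸ ((pow_modEq_pow_mod h5 a).add (pow_modEq_pow_mod h11 b)))

theorem exponents_of_one_add_sieve : ∀ r < 36, ∀ s < 36,
    ([7, 9, 13, 16, 19, 27, 37].all fun m => isTwiceCubeMod m (1 + 5 ^ r * 11 ^ s)) = true →
      r % 6 = 0 ∧ s % 6 = 0 := by
  decide +kernel

theorem exponents_of_add_sieve : ∀ r < 72, ∀ s < 72,
    ([7, 9, 13, 16, 19, 27, 37, 73].all fun m => isTwiceCubeMod m (5 ^ r + 11 ^ s)) = true →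
      (r % 6 = 0 ∧ s % 6 = 0) ∨ (r % 12 = 1 ∧ s % 12 = 1) := by
  decide +kernel

theorem exponents_of_one_add {y a b : ℕ} (h : 2 * y ^ 3 = 1 + 5 ^ a * 11 ^ b) :
    a % 6 = 0 ∧ b % 6 = 0 := by
  have key := exponents_of_one_add_sieve (a % 36) (Nat.mod_lt _ (by norm_num)) (b % 36)
    (Nat.mod_lt _ (by norm_num)) (List.all_eq_true.2 fun m hm => by
      have hm' : 0 < m ∧ 5 ^ 36 ≡ 1 [MOD m] ∧ 11 ^ 36 ≡ 1 [MOD m] := by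
        revert m; decide +kernel
      exact isTwiceCubeMod_one_add 36 hm'.1 hm'.2.1 hm'.2.2 h)
  omega

theorem exponents_of_add {y a b : ℕ} (h : 2 * y ^ 3 = 5 ^ a + 11 ^ b) :
    (a % 6 = 0 ∧ b % 6 = 0) ∨ (a % 12 = 1 ∧ b % 12 = 1) := by
  have key := exponents_of_add_sieve (a % 72) (Nat.mod_lt _ (by norm_num)) (b % 72)
    (Nat.mod_lt _ (by norm_num)) (List.all_eq_true.2 fun m hm => by
      have hm' : 0 < m ∧ 5 ^ 72 ≡ 1 [MOD m] ∧ 11 ^ 72 ≡ 1 [MOD m] := by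
        revert m; decide +kernel
      exact isTwiceCubeMod_add 72 hm'.1 hm'.2.1 hm'.2.2 h)
  omega

theorem exponent_of_five_add_sieve : ∀ t < 11,
    ([67, 199, 661, 1453].all fun m => isTwiceCubeMod m (5 + 11 ^ (12 * t + 1))) = true →
      t = 0 := by
  decide +kernel

theorem exponent_of_five_add {y b : ℕ} (hb : b % 12 = 1) (h : 2 * y ^ 3 = 5 + 11 ^ b) :
    b % 132 = 1 := by
  have key := exponent_of_five_add_sieve (b % 132 / 12) (by omega)
    (List.all_eq_true.2 fun m hm => by
      have hm' : 0 < m ∧ 11 ^ 132 ≡ 1 [MOD m] := by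
        revert m; decide +kernel
      rw [show 12 * (b % 132 / 12) + 1 = b % 132 by omega]
      exact isTwiceCubeMod_of_modEq hm'.1 (h ▸ (pow_modEq_pow_mod hm'.2 b).add_left 5))
  omega

/-- If a sum of two coprime cubes is twice a cube, with bases summing to a number prime to `3`,
then the sum of the bases is twice a cube. -/
theorem exists_add_eq_two_mul_cube {u v y : ℕ} (huv : Nat.Coprime u v) (hu : Odd u) (hv : Odd v)
    (h3 : ¬ 3 ∣ u + v) (h : 2 * y ^ 3 = u ^ 3 + v ^ 3) : ∃ p, 2 * p ^ 3 = u + v := by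
  obtain ⟨s, hs⟩ := (hu.add_odd hv).two_dvd
  have hmul : (s : ℤ) * ((u : ℤ) ^ 2 - u * v + v ^ 2) = (y : ℤ) ^ 3 := by
    have hs' : (u : ℤ) + v = 2 * s := mod_cast hs
    have h' : 2 * (y : ℤ) ^ 3 = u ^ 3 + v ^ 3 := mod_cast h
    refine mul_left_cancel₀ (two_ne_zero (α := ℤ)) ?_
    linear_combination (-((u : ℤ) ^ 2 - u * v + v ^ 2)) * hs' - h'
  have hcop : IsCoprime (s : ℤ) ((u : ℤ) ^ 2 - u * v + v ^ 2) := by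
    have hs' : (u : ℤ) + v = 2 * s := mod_cast hs
    have hsu : IsCoprime (s : ℤ) u := by
      have : IsCoprime ((u : ℤ) + v) u := by
        have := (Nat.isCoprime_iff_coprime.2 huv).symm
        simpa [add_comm] using this.add_mul_left_left 1
      rw [hs'] at this
      exact this.of_mul_left_right
    have hsv : IsCoprime (s : ℤ) v := by
      have : IsCoprime ((u : ℤ) + v) v := by
        have := (Nat.isCoprime_iff_coprime.2 huv)
        simpa [add_comm] using this.add_mul_left_left 1
      rw [hs'] at this
      exact this.of_mul_left_right
    have hs3 : IsCoprime (s : ℤ) 3 := by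
      have : Nat.Coprime s 3 := by
        refine ((Nat.Prime.coprime_iff_not_dvd Nat.prime_three).2 fun hd => h3 ?_).symm
        rw [hs]; exact hd.mul_left 2
      exact_mod_cast Nat.isCoprime_iff_coprime.2 this
    have : IsCoprime (s : ℤ) (-(3 * (u * v))) := (hs3.mul_right (hsu.mul_right hsv)).neg_right
    have hq : (u : ℤ) ^ 2 - u * v + v ^ 2 = -(3 * (u * v)) + s * (4 * s) := by
      linear_combination ((u : ℤ) + v + 2 * s) * hs'
    rw [hq]
    exact this.add_mul_left_right (4 * (s : ℤ))
  obtain ⟨d, hd⟩ := Int.eq_pow_of_mul_eq_pow_odd_left hcop (by decide : Odd 3) hmul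
  refine ⟨d.natAbs, ?_⟩
  have hd0 : 0 ≤ d := by
    by_contra hneg
    have : d ^ 3 < 0 := Odd.pow_neg (by decide) (not_le.1 hneg)
    omega
  have : ((d.natAbs ^ 3 : ℕ) : ℤ) = s := by
    rw [hd]; push_cast; rw [abs_of_nonneg hd0]
  have : d.natAbs ^ 3 = s := by exact_mod_cast this
  omega

theorem eq_zero_of_two_mul_cube_eq_one_add {y a b : ℕ} (h : 2 * y ^ 3 = 1 + 5 ^ a * 11 ^ b) :
    a = 0 ∧ b = 0 := by
  induction hn : a + b using Nat.strong_induction_on generalizing a b y with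
  | _ n ih =>
    by_contra hab
    obtain ⟨ha, hb⟩ := exponents_of_one_add h
    obtain ⟨i, rfl⟩ : ∃ i, a = 2 * i * 3 := ⟨a / 6, by omega⟩
    obtain ⟨j, rfl⟩ : ∃ j, b = 2 * j * 3 := ⟨b / 6, by omega⟩
    rw [pow_mul, pow_mul 11, ← mul_pow] at h
    obtain ⟨p, hp⟩ := exists_add_eq_two_mul_cube (u := 1) (v := 5 ^ (2 * i) * 11 ^ (2 * j))
      (Nat.coprime_one_left _) odd_one
      ((Odd.pow (by decide)).mul (Odd.pow (by decide))) (by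
        have h1 : 5 ^ (2 * i) * 11 ^ (2 * j) ≡ 1 ^ i * 1 ^ j [MOD 3] := by
          rw [pow_mul, pow_mul 11]
          exact (Nat.ModEq.pow i (by decide)).mul (Nat.ModEq.pow j (by decide))
        simp only [one_pow, mul_one, Nat.ModEq] at h1
        omega) (by rw [h, one_pow])
    have := ih _ (by omega) hp rfl
    omega

/-- Elements `x + y θ + z φ`, where `θ = ∛20` and `φ = ∛50`, with coefficients in `R`. -/
@[ext]
structure PureCubic (R : Type*) where
  /-- the coefficient of `1` -/
  x : R
  /-- the coefficient of `θ` -/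
  y : R
  /-- the coefficient of `φ` -/
  z : R

namespace PureCubic

variable {R : Type*} [CommRing R]

instance : Zero (PureCubic R) := ⟨⟨0, 0, 0⟩⟩
instance : One (PureCubic R) := ⟨⟨1, 0, 0⟩⟩
instance : Add (PureCubic R) := ⟨fun a b => ⟨a.x + b.x, a.y + b.y, a.z + b.z⟩⟩
instance : Neg (PureCubic R) := ⟨fun a => ⟨-a.x, -a.y, -a.z⟩⟩
instance : Mul (PureCubic R) :=
  ⟨fun a b => ⟨a.x * b.x + 10 * (a.y * b.z + a.z * b.y),
    a.x * b.y + a.y * b.x + 5 * (a.z * b.z), a.x * b.z + a.z * b.x + 2 * (a.y * b.y)⟩⟩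

@[simp] theorem zero_x : (0 : PureCubic R).x = 0 := rfl
@[simp] theorem zero_y : (0 : PureCubic R).y = 0 := rfl
@[simp] theorem zero_z : (0 : PureCubic R).z = 0 := rfl
@[simp] theorem one_x : (1 : PureCubic R).x = 1 := rfl
@[simp] theorem one_y : (1 : PureCubic R).y = 0 := rfl
@[simp] theorem one_z : (1 : PureCubic R).z = 0 := rfl
@[simp] theorem add_x (a b : PureCubic R) : (a + b).x = a.x + b.x := rfl
@[simp] theorem add_y (a b : PureCubic R) : (a + b).y = a.y + b.y := rfl
@[simp] theorem add_z (a b : PureCubic R) : (a + b).z = a.z + b.z := rfl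
@[simp] theorem neg_x (a : PureCubic R) : (-a).x = -a.x := rfl
@[simp] theorem neg_y (a : PureCubic R) : (-a).y = -a.y := rfl
@[simp] theorem neg_z (a : PureCubic R) : (-a).z = -a.z := rfl
@[simp] theorem mul_x (a b : PureCubic R) :
    (a * b).x = a.x * b.x + 10 * (a.y * b.z + a.z * b.y) := rfl
@[simp] theorem mul_y (a b : PureCubic R) :
    (a * b).y = a.x * b.y + a.y * b.x + 5 * (a.z * b.z) := rfl
@[simp] theorem mul_z (a b : PureCubic R) :
    (a * b).z = a.x * b.z + a.z * b.x + 2 * (a.y * b.y) := rfl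

instance : CommRing (PureCubic R) where
  add_assoc a b c := by ext <;> simp [add_assoc]
  zero_add a := by ext <;> simp
  add_zero a := by ext <;> simp
  add_comm a b := by ext <;> simp [add_comm]
  neg_add_cancel a := by ext <;> simp
  mul_assoc a b c := by ext <;> simp <;> ring
  one_mul a := by ext <;> simp
  mul_one a := by ext <;> simp
  mul_comm a b := by ext <;> simp <;> ring
  left_distrib a b c := by ext <;> simp <;> ring
  right_distrib a b c := by ext <;> simp <;> ring
  zero_mul a := by ext <;> simp
  mul_zero a := by ext <;> simp
  nsmul := nsmulRec
  zsmul := zsmulRec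

/-- The embedding of the scalars. -/
def scalar : R →+* PureCubic R where
  toFun r := ⟨r, 0, 0⟩
  map_one' := rfl
  map_zero' := rfl
  map_add' a b := by ext <;> simp
  map_mul' a b := by ext <;> simp

/-- The norm form. -/
def norm : PureCubic R →* R where
  toFun a := a.x ^ 3 + 20 * a.y ^ 3 + 50 * a.z ^ 3 - 30 * a.x * a.y * a.z
  map_one' := by simp
  map_mul' a b := by simp; ring

theorem norm_mk (x y z : R) :
    norm (⟨x, y, z⟩ : PureCubic R) = x ^ 3 + 20 * y ^ 3 + 50 * z ^ 3 - 30 * x * y * z := rfl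

/-- Evaluation at a compatible pair of cube roots of `20` and `50`. -/
def eval (t f : R) (h1 : t * t = 2 * f) (h2 : f * f = 5 * t) (h3 : t * f = 10) :
    PureCubic ℤ →+* R where
  toFun a := a.x + a.y * t + a.z * f
  map_one' := by simp
  map_zero' := by simp
  map_add' a b := by simp; ring
  map_mul' a b := by
    simp
    linear_combination (-(a.y * b.y : R)) * h1 - (a.z * b.z : R) * h2 -
      (a.y * b.z + a.z * b.y : R) * h3

/-- Reduction of the coefficients. -/
def reduce (R : Type*) [CommRing R] : PureCubic ℤ →+* PureCubic R where
  toFun a := ⟨a.x, a.y, a.z⟩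
  map_one' := by ext <;> simp
  map_zero' := by ext <;> simp
  map_add' a b := by ext <;> simp
  map_mul' a b := by ext <;> simp

@[simp] theorem reduce_x (a : PureCubic ℤ) : (reduce R a).x = a.x := rfl
@[simp] theorem reduce_y (a : PureCubic ℤ) : (reduce R a).y = a.y := rfl
@[simp] theorem reduce_z (a : PureCubic ℤ) : (reduce R a).z = a.z := rfl

/-- The unit `11 + 4θ + 3φ`, with inverse `1 + θ - φ`. -/
def fundUnit : (PureCubic ℤ)ˣ where
  val := ⟨11, 4, 3⟩
  inv := ⟨1, 1, -1⟩
  val_inv := by ext <;> simp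
  inv_val := by ext <;> simp

theorem norm_fundUnit_zpow (n : ℤ) : norm ((fundUnit ^ n : (PureCubic ℤ)ˣ) : PureCubic ℤ) = 1 := by
  have h : Units.map (norm (R := ℤ)) fundUnit = 1 := by
    ext; simp [fundUnit, norm_mk]
  have := congrArg Units.val (map_zpow (Units.map (norm (R := ℤ))) fundUnit n)
  rw [h, one_zpow] at this
  exact this

theorem small_norm_one : ∀ x ∈ Finset.Icc (0 : ℤ) 11, ∀ y ∈ Finset.Icc (0 : ℤ) 4,
    ∀ z ∈ Finset.Icc (0 : ℤ) 3, x ^ 3 + 20 * y ^ 3 + 50 * z ^ 3 - 30 * x * y * z = 1 →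
      (x = 1 ∧ y = 0 ∧ z = 0) ∨ (x = 11 ∧ y = 4 ∧ z = 3) := by
  decide +kernel

theorem three_mul_bounds {A B C s : ℝ} (hs : s = A + B + C) (h1 : 1 ≤ s) (h33 : s < 33)
    (hQ : (A - B) ^ 2 + (B - C) ^ 2 + (C - A) ^ 2 ≤ 2) : -1 ≤ 3 * A ∧ 3 * A < 35 := by
  have hd : (3 * A - s) ^ 2 ≤ 2 ^ 2 := by
    rw [hs]; linarith [sq_nonneg (B - C)]
  have := abs_le_of_sq_le_sq' hd zero_le_two
  constructor <;> linarith

theorem nonneg_of_three_mul_ge {k : ℤ} {r : ℝ} (hr : 1 ≤ r) (h : -1 ≤ 3 * (k * r)) :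
    0 ≤ k := by
  by_contra hk
  have : (k : ℝ) ≤ -1 := by exact_mod_cast (by omega : k ≤ -1)
  nlinarith

theorem le_of_three_mul_lt {k m : ℤ} {r : ℝ} (hr : 0 < r) (hm : 35 ≤ 3 * ((m + 1) * r))
    (h : 3 * (k * r) < 35) : k ≤ m := by
  by_contra hk
  have : (m : ℝ) + 1 ≤ k := by exact_mod_cast (by omega : m + 1 ≤ k)
  nlinarith

theorem eq_fundUnit_zpow_of_norm_eq_one {η : PureCubic ℤ} (hη : norm η = 1) :
    ∃ n : ℤ, η = (fundUnit ^ n : (PureCubic ℤ)ˣ) := by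
  obtain ⟨t, ht0, ht⟩ : ∃ t : ℝ, 0 < t ∧ t ^ 3 = 20 := by
    refine ⟨(20 : ℝ) ^ ((1 : ℝ) / 3), by positivity, ?_⟩
    rw [← Real.rpow_natCast, ← Real.rpow_mul (by norm_num)]
    norm_num
  have ht1 : 2.71 < t := lt_of_pow_lt_pow_left₀ 3 ht0.le (by rw [ht]; norm_num)
  have ht2 : t < 2.72 := lt_of_pow_lt_pow_left₀ 3 (by norm_num) (by rw [ht]; norm_num)
  obtain ⟨f, hf⟩ : ∃ f : ℝ, t * t = 2 * f := ⟨t * t / 2, by ring⟩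
  have hf1 : 3.67 < f := by nlinarith
  have hf2 : f < 3.7 := by nlinarith
  have htf : t * f = 10 := by nlinarith
  have hff : f * f = 5 * t := by
    linear_combination (-(f / 2)) * hf + (t / 2) * htf
  let σ := eval t f hf hff htf
  have hσ (a : PureCubic ℤ) : σ a = a.x + a.y * t + a.z * f := rfl
  have hnorm (a : PureCubic ℤ) (ha : norm a = 1) :
      σ a * ((a.x - a.y * t) ^ 2 + (a.y * t - a.z * f) ^ 2 + (a.z * f - a.x) ^ 2) = 2 := by
    have h : ((norm a : ℤ) : ℝ) = 1 := by rw [ha]; simp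
    simp only [norm, MonoidHom.coe_mk, OneHom.coe_mk] at h
    push_cast at h
    have hf3 : f ^ 3 = 50 := by linear_combination f * hff + 5 * htf
    rw [hσ]
    linear_combination 2 * h + 2 * (a.y : ℝ) ^ 3 * ht + 2 * (a.z : ℝ) ^ 3 * hf3 -
      6 * (a.x * a.y * a.z : ℝ) * htf
  have hpos (a : PureCubic ℤ) (ha : norm a = 1) : 0 < σ a := by
    refine pos_of_mul_pos_left ((hnorm a ha).symm ▸ two_pos) (by positivity)
  have hE : σ fundUnit = 11 + 4 * t + 3 * f := by simp [hσ, fundUnit]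
  obtain ⟨n, hn1, hn2⟩ := exists_mem_Ico_zpow (hpos η hη)
    (show 1 < σ fundUnit by rw [hE]; linarith)
  have hσE (k : ℤ) : σ ((fundUnit ^ k : (PureCubic ℤ)ˣ) : PureCubic ℤ) = σ fundUnit ^ k := by
    have := congrArg Units.val (map_zpow (Units.map (σ : PureCubic ℤ →* ℝ)) fundUnit k)
    rw [Units.val_zpow_eq_zpow_val] at this
    exact this
  have hE0 : 0 < σ fundUnit := by rw [hE]; linarith
  set ζ : PureCubic ℤ := η * (fundUnit ^ (-n) : (PureCubic ℤ)ˣ) with hζ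
  have hζη : η = ζ * (fundUnit ^ n : (PureCubic ℤ)ˣ) := by
    rw [hζ, mul_assoc, ← Units.val_mul, ← zpow_add]; simp
  have hζn : norm ζ = 1 := by rw [hζ, map_mul, hη, norm_fundUnit_zpow, one_mul]
  have hση : σ η = σ ζ * σ fundUnit ^ n := by rw [hζη, map_mul, hσE]
  have hEn : 0 < σ fundUnit ^ n := zpow_pos hE0 n
  have h1 : 1 ≤ σ ζ := by
    rw [hση] at hn1
    exact le_of_mul_le_mul_right (by simpa using hn1) hEn
  have h2 : σ ζ < σ fundUnit := by
    rw [hση, zpow_add_one₀ hE0.ne', mul_comm] at hn2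
    exact lt_of_mul_lt_mul_left hn2 hEn.le
  have hQ := hnorm ζ hζn
  have hs := hσ ζ
  set X : ℝ := (ζ.x : ℝ)
  set Y : ℝ := ζ.y * t with hY
  set Z : ℝ := ζ.z * f with hZ
  have hQ2 : (X - Y) ^ 2 + (Y - Z) ^ 2 + (Z - X) ^ 2 ≤ 2 := by
    have : 0 ≤ (X - Y) ^ 2 + (Y - Z) ^ 2 + (Z - X) ^ 2 := by positivity
    nlinarith
  have h33 : σ ζ < 33 := by rw [hE] at h2; linarith
  have bX := three_mul_bounds hs h1 h33 hQ2
  have bY := three_mul_bounds (A := Y) (B := Z) (C := X) (by rw [hs]; ring) h1 h33 (by linarith)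
  have bZ := three_mul_bounds (A := Z) (B := X) (C := Y) (by rw [hs]; ring) h1 h33 (by linarith)
  have hx0 : 0 ≤ ζ.x := nonneg_of_three_mul_ge le_rfl (by simpa using bX.1)
  have hy0 : 0 ≤ ζ.y := nonneg_of_three_mul_ge (by linarith) bY.1
  have hz0 : 0 ≤ ζ.z := nonneg_of_three_mul_ge (by linarith) bZ.1
  have hx1 : ζ.x ≤ 11 := le_of_three_mul_lt one_pos (by norm_num) (by simpa using bX.2)
  have hy1 : ζ.y ≤ 4 := le_of_three_mul_lt ht0 (by push_cast; linarith) bY.2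
  have hz1 : ζ.z ≤ 3 := le_of_three_mul_lt (by linarith) (by push_cast; linarith) bZ.2
  rcases small_norm_one _ (Finset.mem_Icc.2 ⟨hx0, hx1⟩) _ (Finset.mem_Icc.2 ⟨hy0, hy1⟩) _
    (Finset.mem_Icc.2 ⟨hz0, hz1⟩) hζn with ⟨hx, hy, hz⟩ | ⟨hx, hy, hz⟩
  · refine ⟨n, ?_⟩
    rw [hζη, show ζ = 1 from PureCubic.ext hx hy hz, one_mul]
  · refine absurd h2 (not_lt.2 (le_of_eq ?_))
    rw [show ζ = fundUnit from PureCubic.ext hx hy hz]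

@[simp] theorem scalar_x (r : R) : (scalar r).x = r := rfl
@[simp] theorem scalar_y (r : R) : (scalar r).y = 0 := rfl
@[simp] theorem scalar_z (r : R) : (scalar r).z = 0 := rfl

theorem scalar_mul (r : R) (a : PureCubic R) : scalar r * a = ⟨r * a.x, r * a.y, r * a.z⟩ := by
  ext <;> simp

theorem scalar_mul_left_cancel {r : ℤ} (hr : r ≠ 0) {a b : PureCubic ℤ}
    (h : scalar r * a = scalar r * b) : a = b := by
  simp only [scalar_mul, PureCubic.mk.injEq] at h
  exact PureCubic.ext (mul_left_cancel₀ hr h.1) (mul_left_cancel₀ hr h.2.1)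
    (mul_left_cancel₀ hr h.2.2)

theorem exists_eq_scalar_mul {r s : ℤ} (hrs : IsCoprime r s) {a b : PureCubic ℤ}
    (h : scalar r * a = scalar s * b) : ∃ c, a = scalar s * c := by
  simp only [scalar_mul, PureCubic.mk.injEq] at h
  obtain ⟨cx, hx⟩ := hrs.symm.dvd_of_dvd_mul_left ⟨_, h.1⟩
  obtain ⟨cy, hy⟩ := hrs.symm.dvd_of_dvd_mul_left ⟨_, h.2.1⟩
  obtain ⟨cz, hz⟩ := hrs.symm.dvd_of_dvd_mul_left ⟨_, h.2.2⟩
  exact ⟨⟨cx, cy, cz⟩, by rw [scalar_mul]; exact PureCubic.ext hx hy hz⟩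

/-- The element `4 - θ`, of norm `44`. -/
def fourSubTheta : PureCubic ℤ := ⟨4, -1, 0⟩

/-- The element `8 + 2θ + φ`, whose product with `4 - θ` is `22`. -/
def cofactor : PureCubic ℤ := ⟨8, 2, 1⟩

/-- Half of the cube of `8 + 2θ + φ`. -/
def halfCofactorCube : PureCubic ℤ := ⟨841, 312, 222⟩

theorem cofactor_pow_three : cofactor ^ 3 = scalar 2 * halfCofactorCube := by
  ext <;> simp [cofactor, halfCofactorCube, pow_succ, -eq_intCast]

theorem halfCofactorCube_mul : halfCofactorCube * fourSubTheta ^ 3 = scalar (4 * 11 ^ 3) := by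
  ext <;> simp [fourSubTheta, halfCofactorCube, pow_succ, -eq_intCast, -map_mul]

/-- An element vanishing modulo `11 ^ m` under `θ ↦ r`, `φ ↦ r ^ 2 / 2` becomes divisible by
`11 ^ m` after multiplication by the `m`-th power of `8 + 2θ + φ`. -/
theorem scalar_dvd_mul_cofactor_pow {r : ℤ} (h4 : 11 ∣ r - 4) (m : ℕ) (hr : 11 ^ m ∣ r ^ 3 - 20)
    (β : PureCubic ℤ) (h : 11 ^ m ∣ 2 * β.x + 2 * β.y * r + β.z * r ^ 2) :
    scalar (11 ^ m) ∣ β * cofactor ^ m := by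
  induction m generalizing β with
  | zero => simp
  | succ m ih =>
    obtain ⟨c, hc⟩ : (11 : ℤ) ∣ β.x + 4 * β.y + 8 * β.z := by
      have h' : (11 : ℤ) ∣ 2 * β.x + 2 * β.y * r + β.z * r ^ 2 :=
        (dvd_pow_self 11 m.succ_ne_zero).trans h
      obtain ⟨e, he⟩ := h4
      obtain rfl : r = 4 + 11 * e := by linarith
      obtain ⟨g, hg⟩ := h'
      have : (11 : ℤ) ∣ 2 * (β.x + 4 * β.y + 8 * β.z) :=
        ⟨g - 2 * β.y * e - β.z * e * (8 + 11 * e), by linear_combination hg⟩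
      exact IsCoprime.dvd_of_dvd_mul_left (by norm_num) this
    obtain hx : β.x = 11 * c - 4 * β.y - 8 * β.z := by linarith
    set β' : PureCubic ℤ := ⟨8 * c - 2 * β.y - 4 * β.z, 2 * c - β.z, c⟩ with hβ'
    have hmul : β * cofactor = scalar 11 * β' := by
      ext <;> simp [hβ', cofactor, hx, -eq_intCast] <;> ring
    have hev : (11 : ℤ) ^ m ∣ 2 * β'.x + 2 * β'.y * r + β'.z * r ^ 2 := by
      have h22 : (11 : ℤ) ^ (m + 1) ∣ 11 * (2 * (2 * β'.x + 2 * β'.y * r + β'.z * r ^ 2)) := by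
        have : 11 * (2 * (2 * β'.x + 2 * β'.y * r + β'.z * r ^ 2)) =
            (2 * β.x + 2 * β.y * r + β.z * r ^ 2) * (16 + 4 * r + r ^ 2) -
              (r ^ 3 - 20) * (β.z * r + 2 * β.y + 4 * β.z) := by
          simp only [hβ', hx]; ring
        rw [this]
        exact dvd_sub (h.mul_right _) (hr.mul_right _)
      rw [pow_succ', mul_dvd_mul_iff_left (by norm_num)] at h22
      exact (IsCoprime.pow_left (by norm_num)).dvd_of_dvd_mul_left h22
    obtain ⟨γ, hγ⟩ := ih ((pow_dvd_pow 11 m.le_succ).trans hr) β' hev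
    refine ⟨γ, ?_⟩
    rw [pow_succ', ← mul_assoc, hmul, mul_assoc, hγ, ← mul_assoc, ← map_mul, ← pow_succ']

theorem zmod_eleven_cube_eq : ∀ r : ZMod 11, r ^ 3 - 20 = 0 → r - 4 = 0 := by decide +kernel

theorem exists_unit_of_cube_sub {y u : ℤ} {l : ℕ} (hu : IsCoprime u 11)
    (h : (2 * y) ^ 3 - 20 * u ^ 3 = 4 * 11 ^ (3 * l + 1)) :
    ∃ n : ℤ, scalar (4 ^ l : ℤ) * (⟨2 * y, -u, 0⟩ : PureCubic ℤ) =
      ((fundUnit ^ n : (PureCubic ℤ)ˣ) : PureCubic ℤ) * fourSubTheta ^ (3 * l + 1) := by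
  set b := 3 * l + 1 with hb
  obtain ⟨s, t, hst⟩ : IsCoprime u (11 ^ b) := hu.pow_right
  have hr : (11 : ℤ) ^ b ∣ (2 * y * s) ^ 3 - 20 :=
    ⟨4 * s ^ 3 - 20 * t * ((s * u) ^ 2 + s * u + 1), by
      linear_combination s ^ 3 * h + 20 * ((s * u) ^ 2 + s * u + 1) * hst⟩
  have h4 : (11 : ℤ) ∣ 2 * y * s - 4 := by
    have h11 : ((11 : ℕ) : ℤ) ∣ (2 * y * s) ^ 3 - 20 := (dvd_pow_self 11 (by omega)).trans hr
    rw [← ZMod.intCast_zmod_eq_zero_iff_dvd] at h11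
    have := zmod_eleven_cube_eq ((2 * y * s : ℤ) : ZMod 11) (by simpa using h11)
    refine (ZMod.intCast_zmod_eq_zero_iff_dvd _ 11).1 ?_
    simpa using this
  set α : PureCubic ℤ := ⟨2 * y, -u, 0⟩ with hα
  obtain ⟨γ, hγ⟩ := scalar_dvd_mul_cofactor_pow h4 b hr α
    ⟨4 * y * t, by simp only [hα]; linear_combination (-4 * y) * hst⟩
  set α' : PureCubic ℤ := ⟨8 * y - 5 * u, 2 * y - 4 * u, y - 2 * u⟩ with hα'
  have hαδ : α * cofactor = scalar 2 * α' := by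
    ext <;> simp [hα, hα', cofactor, -eq_intCast] <;> ring
  have hαT : α' * fourSubTheta = scalar 11 * α := by
    ext <;> simp [hα, hα', fourSubTheta, -eq_intCast] <;> ring
  have h2 : scalar (2 ^ (l + 1)) * (α' * halfCofactorCube ^ l) = scalar (11 ^ b) * γ := by
    rw [← hγ, hb, pow_succ' cofactor, pow_mul, cofactor_pow_three, mul_pow, ← mul_assoc α, hαδ,
      ← map_pow, pow_succ', map_mul]
    ring
  obtain ⟨η, hη⟩ := exists_eq_scalar_mul (IsCoprime.pow (by norm_num)) h2
  have hnα' : norm α' = 121 * 11 ^ b := by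
    have : norm α' * 8 = 242 * ((2 * y) ^ 3 - 20 * u ^ 3) := by
      simp only [hα', norm_mk]; ring
    rw [h] at this
    linarith
  have hnη : norm η = 1 := by
    have := congrArg norm hη
    rw [map_mul, map_mul, map_pow, hnα'] at this
    have h1 : norm halfCofactorCube = 11 ^ 6 := by norm_num [halfCofactorCube, norm_mk]
    have h3 : norm (scalar (11 ^ b : ℤ)) = (11 ^ b) ^ 3 := by simp [norm, -map_pow, -eq_intCast]
    rw [h1, h3] at this
    have h5 : (121 : ℤ) * 11 ^ b * (11 ^ 6) ^ l = (11 ^ b) ^ 3 := by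
      rw [hb, show (121 : ℤ) = 11 ^ 2 by norm_num]
      simp only [← pow_mul, ← pow_add]
      congr 1; ring
    rw [h5] at this
    exact (mul_eq_left₀ (by positivity)).1 this.symm
  obtain ⟨n, rfl⟩ := eq_fundUnit_zpow_of_norm_eq_one hnη
  refine ⟨n, scalar_mul_left_cancel (r := 11 ^ b) (by positivity) ?_⟩
  rw [← mul_assoc _ _ (fourSubTheta ^ b), ← hη]
  calc scalar (11 ^ b) * (scalar (4 ^ l) * α)
      = scalar ((4 * 11 ^ 3) ^ l) * (scalar 11 * α) := by
        rw [← mul_assoc, ← mul_assoc, ← map_mul, ← map_mul, hb]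
        congr 2; rw [mul_pow, ← pow_mul]; ring
    _ = (α' * fourSubTheta) * (halfCofactorCube * fourSubTheta ^ 3) ^ l := by
        rw [hαT, halfCofactorCube_mul, map_pow]; ring
    _ = α' * halfCofactorCube ^ l * fourSubTheta ^ b := by
        rw [hb]; ring

theorem exists_zpow_eq_pow {G : Type*} [Group G] {g : G} {N : ℕ} (hN : 0 < N) (hg : g ^ N = 1)
    (n : ℤ) : ∃ i < N, (∃ q : ℤ, n = i + N * q) ∧ g ^ n = g ^ i := by
  have hlt := Int.emod_lt_of_pos n (Int.natCast_pos.2 hN)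
  refine ⟨(n % N).toNat, by omega, ⟨n / N, ?_⟩, ?_⟩
  · rw [Int.toNat_of_nonneg (Int.emod_nonneg _ (by omega)), Int.emod_add_mul_ediv]
  · rw [← zpow_natCast g (n % N).toNat, Int.toNat_of_nonneg (Int.emod_nonneg _ (by omega))]
    conv_lhs => rw [← Int.emod_add_mul_ediv n N, zpow_add, zpow_mul, zpow_natCast, hg]
    simp

theorem mod_five_exponents : ∀ i < 5, ∀ j < 20,
    ((⟨1, 4, 3⟩ : PureCubic (ZMod 5)) ^ i * (⟨4, 4, 0⟩ : PureCubic (ZMod 5)) ^ j).y = 0 →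
    ((⟨1, 4, 3⟩ : PureCubic (ZMod 5)) ^ i * (⟨4, 4, 0⟩ : PureCubic (ZMod 5)) ^ j).z = 0 →
      i = 0 ∧ j % 5 = 0 := by
  decide +kernel

theorem mod_forty_one : ∀ U Y V : ZMod 41, U ^ 5 = 1 → V = 11 ^ 25 ∨ V = - 11 ^ 25 →
    2 * Y ^ 3 = 5 * U ^ 3 + V → (4 ^ 8 * (2 * Y - 8 * U)) ^ 9 ≠ 4 ^ 8 * (2 * Y - 8 * U) := by
  decide +kernel

theorem pow_five_mod_forty_one : ∀ c : ZMod 41, (c ^ 5) ^ 9 = c ^ 5 := by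
  decide +kernel

theorem five_pow_twenty_mod_forty_one : (5 : ZMod 41) ^ 20 = 1 := by decide +kernel

theorem eleven_pow_sixty_mod_forty_one : (11 : ZMod 41) ^ 60 = -1 := by decide +kernel

theorem four_pow_twenty_mod_forty_one : (4 : ZMod 41) ^ 20 = 1 := by decide +kernel

theorem exists_unit_of_two_mul_cube_eq {y k l : ℕ}
    (h : 2 * y ^ 3 = 5 ^ (12 * k + 1) + 11 ^ (12 * l + 1)) :
    ∃ n : ℤ, scalar (4 ^ (4 * l) : ℤ) * (⟨2 * y, -5 ^ (4 * k), 0⟩ : PureCubic ℤ) =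
      ((fundUnit ^ n : (PureCubic ℤ)ˣ) : PureCubic ℤ) * fourSubTheta ^ (12 * l + 1) := by
  have h' : (2 : ℤ) * y ^ 3 = 5 ^ (12 * k + 1) + 11 ^ (12 * l + 1) := by exact_mod_cast h
  obtain ⟨n, hn⟩ := exists_unit_of_cube_sub (y := y) (u := 5 ^ (4 * k)) (l := 4 * l)
    (IsCoprime.pow_left (by norm_num)) (by
      rw [← pow_mul, show 4 * k * 3 = 12 * k by ring, show 3 * (4 * l) = 12 * l by ring]
      rw [pow_succ 5] at h'
      linear_combination 4 * h')
  rw [show 3 * (4 * l) = 12 * l by ring] at hn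
  exact ⟨n, hn⟩

theorem five_exponent_eq_one {y k l : ℕ}
    (h : 2 * y ^ 3 = 5 ^ (12 * k + 1) + 11 ^ (12 * l + 1)) : k = 0 := by
  by_contra hk
  obtain ⟨n, hn⟩ := exists_unit_of_two_mul_cube_eq h
  have hε : (Units.map (reduce (ZMod 5) : PureCubic ℤ →* PureCubic (ZMod 5)) fundUnit) ^ 5 = 1 :=
    Units.ext (PureCubic.ext (by decide +kernel) (by decide +kernel) (by decide +kernel))
  obtain ⟨i, hi, ⟨q, hq⟩, hpow⟩ := exists_zpow_eq_pow (by norm_num) hε n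
  have hred : reduce (ZMod 5) (scalar (4 ^ (4 * l) : ℤ) * ⟨2 * y, -5 ^ (4 * k), 0⟩) =
      ⟨1, 4, 3⟩ ^ i * ⟨4, 4, 0⟩ ^ ((12 * l + 1) % 20) := by
    have hT : reduce (ZMod 5) fourSubTheta = ⟨4, 4, 0⟩ :=
      PureCubic.ext (by decide +kernel) (by decide +kernel) (by decide +kernel)
    have hE : reduce (ZMod 5) fundUnit = ⟨1, 4, 3⟩ :=
      PureCubic.ext (by decide +kernel) (by decide +kernel) (by decide +kernel)
    have hT20 : (⟨4, 4, 0⟩ : PureCubic (ZMod 5)) ^ 20 = 1 :=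
      PureCubic.ext (by decide +kernel) (by decide +kernel) (by decide +kernel)
    have hEn : reduce (ZMod 5) (fundUnit ^ n : (PureCubic ℤ)ˣ) = ⟨1, 4, 3⟩ ^ i := by
      rw [← map_zpow] at hpow
      have := congrArg Units.val hpow
      rw [Units.val_pow_eq_pow_val] at this
      rw [← hE]
      exact this
    rw [hn, map_mul, hEn, map_pow, hT, pow_eq_pow_mod (12 * l + 1) hT20]
  have h5 : (5 : ZMod 5) = 0 := rfl
  have hy := congrArg PureCubic.y hred
  have hz := congrArg PureCubic.z hred
  rw [scalar_mul] at hy hz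
  simp only [reduce_y, reduce_z] at hy hz
  push_cast at hy hz
  rw [h5, zero_pow (by omega), neg_zero, mul_zero] at hy
  rw [mul_zero] at hz
  obtain ⟨rfl, hj⟩ := mod_five_exponents i hi ((12 * l + 1) % 20) (Nat.mod_lt _ (by norm_num))
    hy.symm hz.symm
  obtain ⟨p, rfl⟩ : ∃ p, l = 5 * p + 2 := ⟨l / 5, by omega⟩
  obtain rfl : n = q * 5 := by push_cast at hq; omega
  have hfive : ((fundUnit ^ (q * 5) : (PureCubic ℤ)ˣ) : PureCubic ℤ) *
      fourSubTheta ^ (12 * (5 * p + 2) + 1) =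
      ((fundUnit ^ q : (PureCubic ℤ)ˣ) * fourSubTheta ^ (12 * p + 5)) ^ 5 := by
    rw [mul_pow, ← Units.val_pow_eq_pow_val, ← pow_mul, zpow_mul]
    congr 2
    ring
  rw [hfive] at hn
  let σ := eval (8 : ZMod 41) 32 (by decide) (by decide) (by decide)
  have hσ := congrArg σ hn
  rw [scalar_mul, map_pow] at hσ
  have hL : σ ⟨4 ^ (4 * (5 * p + 2)) * (2 * y), 4 ^ (4 * (5 * p + 2)) * -5 ^ (4 * k),
      4 ^ (4 * (5 * p + 2)) * 0⟩ = 4 ^ 8 * (2 * (y : ZMod 41) - 8 * 5 ^ (4 * k)) := by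
    have h4 : (4 : ZMod 41) ^ (4 * (5 * p + 2)) = 4 ^ 8 := by
      rw [show 4 * (5 * p + 2) = 20 * p + 8 by ring, pow_add, pow_mul,
        four_pow_twenty_mod_forty_one, one_pow, one_mul]
    change (((4 ^ (4 * (5 * p + 2)) * (2 * y) : ℤ) : ZMod 41) +
      ((4 ^ (4 * (5 * p + 2)) * -5 ^ (4 * k) : ℤ) : ZMod 41) * 8 +
      ((4 ^ (4 * (5 * p + 2)) * 0 : ℤ) : ZMod 41) * 32) = _
    push_cast
    rw [h4]
    ring
  rw [hL] at hσ
  refine mod_forty_one (5 ^ (4 * k)) y (11 ^ (12 * (5 * p + 2) + 1)) ?_ ?_ ?_ ?_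
  · rw [← pow_mul, show 4 * k * 5 = 20 * k by ring, pow_mul, five_pow_twenty_mod_forty_one, one_pow]
  · rw [show 12 * (5 * p + 2) + 1 = 60 * p + 25 by ring, pow_add, pow_mul,
      eleven_pow_sixty_mod_forty_one]
    rcases neg_one_pow_eq_or (ZMod 41) p with h1 | h1 <;> rw [h1]
    · exact Or.inl (one_mul _)
    · exact Or.inr (neg_one_mul _)
  · have := congrArg (Nat.cast : ℕ → ZMod 41) h
    push_cast at this
    rw [this, pow_succ, ← pow_mul, show 4 * k * 3 = 12 * k by ring, mul_comm (5 : ZMod 41)]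
  · rw [hσ]
    exact pow_five_mod_forty_one _

theorem cube_root_twenty_mod : ∀ t : ZMod 121, t ^ 3 = 20 → t = -7 := by decide +kernel

theorem four_pow_mod : (4 : ZMod 121) ^ 110 = 1 := by decide +kernel

theorem fundUnit_pow_mod : (⟨11, 4, 3⟩ : PureCubic (ZMod 121)) ^ 120 = ⟨1, 33, 88⟩ :=
  PureCubic.ext (by decide +kernel) (by decide +kernel) (by decide +kernel)

theorem fundUnit_pow_pow_mod : (⟨1, 33, 88⟩ : PureCubic (ZMod 121)) ^ 11 = 1 :=
  PureCubic.ext (by decide +kernel) (by decide +kernel) (by decide +kernel)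

theorem fourSubTheta_pow_mod : (⟨4, -1, 0⟩ : PureCubic (ZMod 121)) ^ 120 = ⟨85, 76, 38⟩ :=
  PureCubic.ext (by decide +kernel) (by decide +kernel) (by decide +kernel)

theorem fourSubTheta_pow_pow_mul_mod :
    (⟨85, 76, 38⟩ : PureCubic (ZMod 121)) ^ 11 * ⟨-7, -1, 0⟩ = ⟨-7, -1, 0⟩ :=
  PureCubic.ext (by decide +kernel) (by decide +kernel) (by decide +kernel)

theorem neg_seven_sub_theta_pow_mod :
    (⟨-7, -1, 0⟩ : PureCubic (ZMod 121)) ^ 120 = ⟨96, 76, 82⟩ :=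
  PureCubic.ext (by decide +kernel) (by decide +kernel) (by decide +kernel)

theorem mod_one_hundred_twenty_one : ∀ i < 11,
    ((⟨96, 76, 82⟩ : PureCubic (ZMod 121)) * ⟨-7, -1, 0⟩).x ≠
      ((⟨1, 33, 88⟩ : PureCubic (ZMod 121)) ^ i * (⟨85, 76, 38⟩ * ⟨-7, -1, 0⟩)).x ∨
    ((⟨96, 76, 82⟩ : PureCubic (ZMod 121)) * ⟨-7, -1, 0⟩).y ≠
      ((⟨1, 33, 88⟩ : PureCubic (ZMod 121)) ^ i * (⟨85, 76, 38⟩ * ⟨-7, -1, 0⟩)).y ∨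
    ((⟨96, 76, 82⟩ : PureCubic (ZMod 121)) * ⟨-7, -1, 0⟩).z ≠
      ((⟨1, 33, 88⟩ : PureCubic (ZMod 121)) ^ i * (⟨85, 76, 38⟩ * ⟨-7, -1, 0⟩)).z := by
  decide +kernel

theorem eleven_exponent_eq_one {y l : ℕ} (h : 2 * y ^ 3 = 5 + 11 ^ (12 * l + 1)) : l = 0 := by
  by_contra hl
  obtain ⟨m, rfl⟩ : ∃ m, l = 11 * m :=
    ⟨l / 11, by have := exponent_of_five_add (by omega) h; omega⟩
  obtain ⟨n, hn⟩ := exists_unit_of_two_mul_cube_eq (k := 0) (l := 11 * m) (by simpa using h)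
  have hy : (2 : ZMod 121) * y = -7 := by
    refine cube_root_twenty_mod _ ?_
    have := congrArg (Nat.cast : ℕ → ZMod 121) h
    push_cast at this
    have h11 : (11 : ZMod 121) ^ 2 = 0 := rfl
    rw [pow_eq_zero_of_le (show 2 ≤ 12 * (11 * m) + 1 by omega) h11] at this
    linear_combination 4 * this
  set ε := Units.map (reduce (ZMod 121) : PureCubic ℤ →* PureCubic (ZMod 121)) fundUnit with hε
  have hεv : (ε : PureCubic (ZMod 121)) = ⟨11, 4, 3⟩ :=
    PureCubic.ext (by decide +kernel) (by decide +kernel) (by decide +kernel)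
  have hε11 : (ε ^ 120) ^ 11 = 1 := Units.ext (by
    rw [Units.val_pow_eq_pow_val, Units.val_pow_eq_pow_val, hεv, fundUnit_pow_mod,
      fundUnit_pow_pow_mod, Units.val_one])
  obtain ⟨i, hi, -, hpow⟩ := exists_zpow_eq_pow (by norm_num) hε11 n
  have hEn : (reduce (ZMod 121) (fundUnit ^ n : (PureCubic ℤ)ˣ)) ^ 120 = ⟨1, 33, 88⟩ ^ i := by
    have h1 : reduce (ZMod 121) (fundUnit ^ n : (PureCubic ℤ)ˣ) =
        (ε ^ n : (PureCubic (ZMod 121))ˣ) := by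
      rw [hε, ← map_zpow]; rfl
    rw [h1, ← Units.val_pow_eq_pow_val, ← zpow_natCast, zpow_comm, zpow_natCast, hpow,
      Units.val_pow_eq_pow_val, Units.val_pow_eq_pow_val, hεv, fundUnit_pow_mod]
  have hT : (reduce (ZMod 121) fourSubTheta) = ⟨4, -1, 0⟩ :=
    PureCubic.ext (by decide +kernel) (by decide +kernel) (by decide +kernel)
  have hL : reduce (ZMod 121) (scalar (4 ^ (4 * (11 * m)) : ℤ) * ⟨2 * y, -5 ^ (4 * 0), 0⟩) =
      scalar (4 ^ (4 * (11 * m))) * ⟨-7, -1, 0⟩ := by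
    rw [scalar_mul, scalar_mul, ← hy]
    ext <;> simp
  have h4 : (scalar ((4 : ZMod 121) ^ (4 * (11 * m)))) ^ 120 = 1 := by
    rw [← map_pow, ← pow_mul, show 4 * (11 * m) * 120 = 110 * (48 * m) by ring, pow_mul,
      four_pow_mod, one_pow, map_one]
  have hTw (j : ℕ) : ((⟨85, 76, 38⟩ : PureCubic (ZMod 121)) ^ 11) ^ j * ⟨-7, -1, 0⟩ =
      ⟨-7, -1, 0⟩ := by
    induction j with
    | zero => simp
    | succ j ih => rw [pow_succ, mul_assoc, fourSubTheta_pow_pow_mul_mod, ih]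
  have key : (⟨96, 76, 82⟩ : PureCubic (ZMod 121)) * ⟨-7, -1, 0⟩ =
      ⟨1, 33, 88⟩ ^ i * (⟨85, 76, 38⟩ * ⟨-7, -1, 0⟩) := by
    have h1 := congrArg (fun a => reduce (ZMod 121) a ^ 120 * ⟨-7, -1, 0⟩) hn
    rw [hL, mul_pow, h4, one_mul, neg_seven_sub_theta_pow_mod, map_mul, mul_pow, hEn, map_pow, hT,
      ← pow_mul, show (12 * (11 * m) + 1) * 120 = 120 * (11 * (12 * m) + 1) by ring, pow_mul,
      fourSubTheta_pow_mod, pow_succ, pow_mul, mul_comm (_ ^ (12 * m)), mul_assoc, mul_assoc,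
      hTw] at h1
    exact h1
  rcases mod_one_hundred_twenty_one i hi with h1 | h1 | h1
  · exact h1 (congrArg PureCubic.x key)
  · exact h1 (congrArg PureCubic.y key)
  · exact h1 (congrArg PureCubic.z key)

end PureCubic

/-- The only sums `5 ^ a + 11 ^ b` that are twice a cube are `1 + 1` and `5 + 11`. -/
theorem exponents_of_two_mul_cube_eq_add {y a b : ℕ}
    (h : 2 * y ^ 3 = 5 ^ a + 11 ^ b) :
    (a = 0 ∧ b = 0) ∨ (a = 1 ∧ b = 1) := by
  induction hn : a + b using Nat.strong_induction_on generalizing a b y with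
  | _ n ih =>
    by_contra hab
    rcases exponents_of_add h with ⟨ha, hb⟩ | ⟨ha, hb⟩
    · obtain ⟨i, rfl⟩ : ∃ i, a = 2 * i * 3 := ⟨a / 6, by omega⟩
      obtain ⟨j, rfl⟩ : ∃ j, b = 2 * j * 3 := ⟨b / 6, by omega⟩
      rw [pow_mul, pow_mul 11] at h
      obtain ⟨p, hp⟩ := exists_add_eq_two_mul_cube (u := 5 ^ (2 * i)) (v := 11 ^ (2 * j))
        (Nat.Coprime.pow _ _ (by decide)) (Odd.pow (by decide)) (Odd.pow (by decide)) (by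
          have h1 : 5 ^ (2 * i) + 11 ^ (2 * j) ≡ 1 ^ i + 1 ^ j [MOD 3] := by
            rw [pow_mul, pow_mul 11]
            exact (Nat.ModEq.pow i (by decide)).add (Nat.ModEq.pow j (by decide))
          simp only [one_pow, Nat.ModEq] at h1
          omega) h
      have := ih _ (by omega) hp rfl
      omega
    · obtain ⟨k, rfl⟩ : ∃ k, a = 12 * k + 1 := ⟨a / 12, by omega⟩
      obtain ⟨l, rfl⟩ : ∃ l, b = 12 * l + 1 := ⟨b / 12, by omega⟩
      obtain rfl := PureCubic.five_exponent_eq_one h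
      obtain rfl := PureCubic.eleven_exponent_eq_one (by simpa using h)
      exact hab (Or.inr ⟨rfl, rfl⟩)

theorem pow_dvd_or_pow_dvd_of_coprime {m n p k : ℕ} (hmn : m.Coprime n) (hp : p.Prime)
    (h : p ^ k ∣ m * n) : p ^ k ∣ m ∨ p ^ k ∣ n := by
  rcases Nat.eq_zero_or_pos k with rfl | hk
  · simp
  · exact (hmn.isPrimePow_dvd_mul (hp.isPrimePow.pow hk.ne')).1 h

theorem add_eq_of_coprime_of_mul_eq {m n a b : ℕ} (hmn : m.Coprime n)
    (h : m * n = 5 ^ a * 11 ^ b) : m + n = 1 + 5 ^ a * 11 ^ b ∨ m + n = 5 ^ a + 11 ^ b := by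
  have hcop : (5 ^ a).Coprime (11 ^ b) := Nat.Coprime.pow _ _ (by decide)
  have hpos : 0 < 5 ^ a * 11 ^ b := by positivity
  have hfull {m n : ℕ} (h : m * n = 5 ^ a * 11 ^ b) (h5 : 5 ^ a ∣ m) (h11 : 11 ^ b ∣ m) :
      m + n = 1 + 5 ^ a * 11 ^ b := by
    obtain ⟨c, rfl⟩ := hcop.mul_dvd_of_dvd_of_dvd h5 h11
    rw [mul_assoc] at h
    obtain ⟨rfl, rfl⟩ := mul_eq_one.1 ((Nat.mul_eq_left hpos.ne').1 h)
    ring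
  have hsplit {m n : ℕ} (h : m * n = 5 ^ a * 11 ^ b) (h5 : 5 ^ a ∣ m) (h11 : 11 ^ b ∣ n) :
      m + n = 5 ^ a + 11 ^ b := by
    obtain ⟨c, rfl⟩ := h5
    obtain ⟨d, rfl⟩ := h11
    rw [mul_mul_mul_comm] at h
    obtain ⟨rfl, rfl⟩ := mul_eq_one.1 ((Nat.mul_eq_left hpos.ne').1 h)
    ring
  have h' : n * m = 5 ^ a * 11 ^ b := by rw [mul_comm, h]
  rcases pow_dvd_or_pow_dvd_of_coprime hmn Nat.prime_five (k := a) ⟨11 ^ b, h⟩ with h5 | h5 <;>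
  rcases pow_dvd_or_pow_dvd_of_coprime hmn (by norm_num : Nat.Prime 11)
    (k := b) ⟨5 ^ a, h.trans (mul_comm _ _)⟩ with h11 | h11
  · exact Or.inl (hfull h h5 h11)
  · exact Or.inr (hsplit h h5 h11)
  · exact Or.inr (add_comm m n ▸ hsplit h' h5 h11)
  · exact Or.inl (add_comm m n ▸ hfull h' h5 h11)

theorem solutions_n_eq_6 (x y a b : ℕ) (hx : 0 < x) (hy : 0 < y)
    (hgcd : Nat.gcd x y = 1) :
    x ^ 2 + 5 ^ a * 11 ^ b = y ^ 6 ↔ (a, b, x, y) = (1, 1, 3, 2) := by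
  constructor
  · intro h
    have hodd : Odd (5 ^ a * 11 ^ b) := (Odd.pow (by decide)).mul (Odd.pow (by decide))
    have hlt : x < y ^ 3 := by
      refine lt_of_pow_lt_pow_left₀ 2 (Nat.zero_le _) ?_
      rw [← pow_mul, ← h]
      exact Nat.lt_add_of_pos_right (by positivity)
    obtain ⟨m, hm⟩ := Nat.exists_eq_add_of_le hlt.le
    have hprod : m * (m + 2 * x) = 5 ^ a * 11 ^ b := by
      have : x ^ 2 + 5 ^ a * 11 ^ b = x ^ 2 + m * (m + 2 * x) := by
        rw [h, show y ^ 6 = (y ^ 3) ^ 2 by ring, hm]; ring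
      exact (Nat.add_left_cancel this).symm
    have hmodd : Odd m := (Nat.odd_mul.1 (hprod ▸ hodd)).1
    have hmx : m.Coprime x := by
      have : (y ^ 3).Coprime x := Nat.Coprime.pow_left 3 (Nat.coprime_comm.1 hgcd)
      rw [hm] at this
      simpa using this
    have hcop : m.Coprime (m + 2 * x) := by
      rw [Nat.coprime_self_add_right]
      exact (Nat.coprime_two_right.2 hmodd).mul_right hmx
    have hsum : m + (m + 2 * x) = 2 * y ^ 3 := by omega
    have hzero : ¬ (a = 0 ∧ b = 0) := by
      rintro ⟨rfl, rfl⟩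
      have := mul_eq_one.1 (hprod.trans (by norm_num))
      omega
    rcases add_eq_of_coprime_of_mul_eq hcop hprod with h1 | h1
    · exact absurd (eq_zero_of_two_mul_cube_eq_one_add (hsum.symm.trans h1)) hzero
    · rcases exponents_of_two_mul_cube_eq_add (hsum.symm.trans h1) with h0 | ⟨rfl, rfl⟩
      · exact absurd h0 hzero
      · have hy8 : y ^ 3 = 2 ^ 3 := by omega
        obtain rfl : y = 2 := Nat.pow_left_injective (by norm_num) hy8
        obtain rfl : x = 3 := Nat.pow_left_injective (n := 2) (by norm_num) (by simp; omega)
        rfl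
  · rintro ⟨⟩
    norm_num
end

section
/- The equation x^2 + 5^a·11^b = y^5 has no solutions in positive integers x, y with gcd(x,y)=1 and nonnegative integers a, b such that a, b, x are all odd. -/
open Polynomial NumberField

noncomputable section

/-- An integral quintic polynomial, Eisenstein at `5`. -/
def quinticPoly : ℤ[X] :=
  X ^ 5 + C 5 * X ^ 4 - C 10 * X ^ 3 - C 50 * X ^ 2 + C 25 * X + C 15

lemma quinticPoly_natDegree : quinticPoly.natDegree = 5 := by
  unfold quinticPoly; compute_degree!

lemma quinticPoly_monic : quinticPoly.Monic := by
  unfold quinticPoly; monicity!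

lemma quinticPoly_isEisensteinAt : quinticPoly.IsEisensteinAt (Submodule.span ℤ {5}) := by
  refine ⟨?_, ?_, ?_⟩
  · rw [quinticPoly_monic.leadingCoeff]
    change _ ∉ Ideal.span {(5 : ℤ)}
    rw [Ideal.mem_span_singleton]; norm_num
  · intro n hn
    rw [quinticPoly_natDegree] at hn
    change _ ∈ Ideal.span {(5 : ℤ)}
    rw [Ideal.mem_span_singleton]
    rw [quinticPoly]
    interval_cases n <;>
      simp [coeff_X]
  · change _ ∉ (Ideal.span {(5 : ℤ)}) ^ 2
    rw [Ideal.span_singleton_pow, Ideal.mem_span_singleton]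
    have : quinticPoly.coeff 0 = 15 := by
      rw [coeff_zero_eq_eval_zero]; simp [quinticPoly]
    rw [this]; norm_num

lemma quinticPoly_irreducible : Irreducible quinticPoly :=
  quinticPoly_isEisensteinAt.irreducible
    ((Ideal.span_singleton_prime (by norm_num)).2 (by norm_num)) quinticPoly_monic.isPrimitive
    (by rw [quinticPoly_natDegree]; norm_num)

lemma quinticPoly_map_irreducible : Irreducible (quinticPoly.map (algebraMap ℤ ℚ)) :=
  (quinticPoly_monic.irreducible_iff_irreducible_map_fraction_map).1 quinticPoly_irreducible

variable {L : Type*} [Field L] [NumberField L]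

lemma aeval_quinticPoly {S : Type*} [CommRing S] (v : S) :
    aeval v quinticPoly = v ^ 5 + 5 * v ^ 4 - 10 * v ^ 3 - 50 * v ^ 2 + 25 * v + 15 := by
  simp only [quinticPoly, map_add, map_sub, map_mul, map_pow, aeval_X, aeval_C]
  simp

lemma minpoly_eq_quinticPoly {K : Type*} [CommRing K] [IsDomain K] [CharZero K] {v : K}
    (hv : aeval v quinticPoly = 0) :
    minpoly ℤ v = quinticPoly := by
  have hgen : IsIntegral ℤ v := ⟨quinticPoly, quinticPoly_monic, hv⟩
  exact eq_of_monic_of_associated (minpoly.monic hgen) quinticPoly_monic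
    ((minpoly.irreducible hgen).associated_of_dvd quinticPoly_irreducible
      (minpoly.isIntegrallyClosed_dvd hgen hv))

lemma finrank_eq_five (pb : PowerBasis ℚ L) (hv : aeval pb.gen quinticPoly = 0) :
    Module.finrank ℚ L = 5 := by
  have hgen : IsIntegral ℤ pb.gen := ⟨quinticPoly, quinticPoly_monic, hv⟩
  rw [pb.finrank, ← pb.natDegree_minpoly,
    minpoly.isIntegrallyClosed_eq_field_fractions' ℚ hgen, minpoly_eq_quinticPoly hv,
    quinticPoly_monic.natDegree_map, quinticPoly_natDegree]

/-- The index of the order generated by a root of `quinticPoly` divides a power of `198`. -/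
lemma smul_mem_adjoin_of_isIntegral (pb : PowerBasis ℚ L) (hroot : aeval pb.gen quinticPoly = 0)
    {z : L} (hz : IsIntegral ℤ z) : (198 ^ 5 : ℤ) • z ∈ Algebra.adjoin ℤ {pb.gen} := by
  have hvint : IsIntegral ℤ pb.gen := ⟨quinticPoly, quinticPoly_monic, hroot⟩
  have hd := Algebra.discr_mul_isIntegral_mem_adjoin (R := ℤ) ℚ hvint hz
  have hmin := minpoly_eq_quinticPoly hroot
  rw [Algebra.discr_powerBasis_eq_norm, minpoly.isIntegrallyClosed_eq_field_fractions' ℚ hvint,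
    hmin, finrank_eq_five pb hroot] at hd
  refine mem_adjoin_of_smul_prime_pow_smul_of_minpoly_isEisensteinAt (K := ℚ) (p := 5) (n := 10)
    (by norm_num) hvint (hz.smul _) ?_ (by rw [hmin]; exact quinticPoly_isEisensteinAt)
  have hfin := finrank_eq_five pb hroot
  generalize pb.gen = v at *
  rw [aeval_quinticPoly] at hroot
  have hder : aeval v (derivative (quinticPoly.map (algebraMap ℤ ℚ))) =
      5 * v ^ 4 + 20 * v ^ 3 - 30 * v ^ 2 - 100 * v + 25 := by
    simp only [quinticPoly, Polynomial.map_add, Polynomial.map_sub, Polynomial.map_mul,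
      Polynomial.map_pow, map_X, map_C, derivative_X_pow,
      derivative_C_mul, derivative_X, derivative_C, map_add, map_sub, map_mul, map_pow, aeval_X,
      aeval_C, map_one, map_zero]
    simp
    ring
  rw [hder] at hd
  set δ := 5 * v ^ 4 + 20 * v ^ 3 - 30 * v ^ 2 - 100 * v + 25 with hδ
  set κ := 45 - 135 * v - 40 * v ^ 2 + 16 * v ^ 3 + 4 * v ^ 4 with hκ
  have hprod : κ * δ = algebraMap ℚ _ 4950 := by
    rw [hκ, hδ, map_ofNat]
    linear_combination (-255 - 100 * v + 60 * v ^ 2 + 20 * v ^ 3) * hroot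
  have hκint : IsIntegral ℤ κ := by
    have : κ = aeval v (C 45 - C 135 * X - C 40 * X ^ 2 + C 16 * X ^ 3 + C 4 * X ^ 4 : ℤ[X]) := by
      simp only [hκ, map_add, map_sub, map_mul, map_pow, aeval_X, aeval_C]
      simp
    rw [this]
    exact IsIntegral.of_mem_of_fg _ hvint.fg_adjoin_singleton _ (aeval_mem_adjoin_singleton _ _)
  obtain ⟨E, hE⟩ := IsIntegrallyClosed.isIntegral_iff.1 (Algebra.isIntegral_norm ℚ hκint)
  have hnorm : Algebra.norm ℚ κ * Algebra.norm ℚ δ = 4950 ^ 5 := by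
    rw [← map_mul, hprod, Algebra.norm_algebraMap, hfin]
  have := Subalgebra.smul_mem _ hd E
  convert this using 1
  rw [← mul_smul, ← algebraMap_smul ℚ E, ← mul_smul, hE, ← algebraMap_smul ℚ (_ : ℤ)]
  congr 1
  norm_num
  rw [hnorm]
  norm_num

lemma exists_quinticField : ∃ (L : Type) (_ : Field L) (_ : NumberField L) (pb : PowerBasis ℚ L),
    aeval pb.gen quinticPoly = 0 := by
  have : Fact (Irreducible (quinticPoly.map (algebraMap ℤ ℚ))) := ⟨quinticPoly_map_irreducible⟩
  let pb := AdjoinRoot.powerBasis quinticPoly_map_irreducible.ne_zero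
  refine ⟨AdjoinRoot (quinticPoly.map (algebraMap ℤ ℚ)), inferInstance,
    { to_charZero := inferInstance, to_finiteDimensional := pb.finite }, pb, ?_⟩
  have h := AdjoinRoot.aeval_eq (f := quinticPoly.map (algebraMap ℤ ℚ))
    (quinticPoly.map (algebraMap ℤ ℚ))
  rw [AdjoinRoot.mk_self, aeval_map_algebraMap] at h
  exact h

lemma aeval_eq_aeval_of_aeval_eq {v : 𝓞 L} (hv : aeval v quinticPoly = 0) {S : Type*} [CommRing S]
    {s : S} (hs : aeval s quinticPoly = 0) {P Q : ℤ[X]} (h : aeval v P = aeval v Q) :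
    aeval s P = aeval s Q := by
  have hgen : IsIntegral ℤ v := ⟨quinticPoly, quinticPoly_monic, hv⟩
  obtain ⟨T, hT⟩ := minpoly.isIntegrallyClosed_dvd hgen
    (show aeval v (P - Q) = 0 by rw [map_sub, h, sub_self])
  rw [← sub_eq_zero, ← map_sub, hT, minpoly_eq_quinticPoly hv, map_mul, hs, zero_mul]

/-- Every ring in which `198` is invertible and `quinticPoly` has a root receives a homomorphism
from the ring of integers. -/
lemma exists_ringHom_of_root (pb : PowerBasis ℚ L) {v : 𝓞 L} (hpb : (v : L) = pb.gen)
    (hv : aeval v quinticPoly = 0) {S : Type*} [CommRing S] {s : S}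
    (hs : aeval s quinticPoly = 0) (hunit : IsUnit (198 : S)) : ∃ Φ : 𝓞 L →+* S, Φ v = s := by
  have hroot : aeval pb.gen quinticPoly = 0 := by
    rw [← hpb]
    have := congrArg (algebraMap (𝓞 L) L) hv
    rwa [← aeval_algebraMap_apply, map_zero] at this
  have hex : ∀ z : 𝓞 L, ∃ h : ℤ[X], (198 ^ 5 : 𝓞 L) * z = aeval v h := by
    intro z
    have := smul_mem_adjoin_of_isIntegral pb hroot z.isIntegral_coe
    rw [Algebra.adjoin_singleton_eq_range_aeval] at this
    obtain ⟨h, hh⟩ := this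
    refine ⟨h, RingOfIntegers.ext ?_⟩
    have e : algebraMap (𝓞 L) L (aeval v h) = aeval (v : L) h :=
      (aeval_algebraMap_apply L v h).symm
    rw [hpb] at e
    change aeval pb.gen h = _ at hh
    change algebraMap (𝓞 L) L _ = algebraMap (𝓞 L) L _
    rw [e, hh, map_mul, map_pow, map_ofNat, zsmul_eq_mul]
    norm_num
  choose rep hrep using hex
  have key {P Q : ℤ[X]} (h : aeval v P = aeval v Q) : aeval s P = aeval s Q :=
    aeval_eq_aeval_of_aeval_eq hv hs h
  have hN : IsUnit (198 ^ 5 : S) := hunit.pow 5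
  have hNS : aeval s (C (198 ^ 5) : ℤ[X]) = (198 ^ 5 : S) := by
    rw [aeval_C, eq_intCast]; norm_num
  have hNv : aeval v (C (198 ^ 5) : ℤ[X]) = (198 ^ 5 : 𝓞 L) := by
    rw [aeval_C, eq_intCast]; norm_num
  obtain ⟨N, hN⟩ := hN
  have hinv : (↑N⁻¹ : S) * 198 ^ 5 = 1 := by rw [← hN]; simp
  refine ⟨{ toFun := fun z ↦ ↑N⁻¹ * aeval s (rep z), map_one' := ?_, map_mul' := ?_,
            map_zero' := ?_, map_add' := ?_ }, ?_⟩
  · have := key (P := rep 1) (Q := C (198 ^ 5)) (by rw [← hrep, hNv, mul_one])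
    rw [this, hNS, hinv]
  · intro x y
    have := key (P := C (198 ^ 5) * rep (x * y)) (Q := rep x * rep y) (by
      rw [map_mul, map_mul, hNv, ← hrep, ← hrep, ← hrep]; ring)
    rw [map_mul, map_mul, hNS] at this
    linear_combination (↑N⁻¹ : S) ^ 2 * this - (↑N⁻¹ : S) * aeval s (rep (x * y)) * hinv
  · have := key (P := rep 0) (Q := 0) (by rw [← hrep, mul_zero, map_zero])
    rw [this, map_zero, mul_zero]
  · intro x y
    have := key (P := rep (x + y)) (Q := rep x + rep y) (by
      rw [map_add, ← hrep, ← hrep, ← hrep]; ring)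
    rw [this, map_add, mul_add]
  · have := key (P := rep v) (Q := C (198 ^ 5) * X) (by rw [← hrep, map_mul, hNv, aeval_X])
    change ↑N⁻¹ * aeval s (rep v) = s
    rw [this, map_mul, hNS, aeval_X]
    linear_combination s * hinv

/-- In a number field of degree five, four units that are independent modulo fifth powers generate
all units modulo fifth powers. -/
lemma exists_eq_prod_mul_pow_five (hfin : Module.finrank ℚ L = 5) (u : Fin 4 → (𝓞 L)ˣ)
    (hu : ∀ (e : Fin 4 → ℕ) x, ∏ j, u j ^ e j = x ^ 5 → ∀ i, 5 ∣ e i)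
    (η : (𝓞 L)ˣ) : ∃ (e : Fin 4 → Fin 5) (x : (𝓞 L)ˣ), η = (∏ j, u j ^ (e j : ℕ)) * x ^ 5 := by
  let P : Subgroup (𝓞 L)ˣ := (powMonoidHom 5 : (𝓞 L)ˣ →* (𝓞 L)ˣ).range
  have hrank : Units.rank L ≤ 4 := by
    have h1 := InfinitePlace.card_add_two_mul_card_eq_rank L
    have h2 := InfinitePlace.card_eq_nrRealPlaces_add_nrComplexPlaces L
    rw [Units.rank]
    omega
  have hsurj : Function.Surjective (fun e : Fin (Units.rank L) → Fin 5 ↦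
      (QuotientGroup.mk (∏ i, Units.fundSystem L i ^ (e i : ℕ)) : (𝓞 L)ˣ ⧸ P)) := by
    intro q
    obtain ⟨x, rfl⟩ := QuotientGroup.mk_surjective q
    obtain ⟨⟨ξ, k⟩, hx, -⟩ := Units.exist_unique_eq_mul_prod L x
    have hodd : Odd (Module.finrank ℚ L) := by rw [hfin]; decide
    have hξ : (ξ : (𝓞 L)ˣ) = (ξ : (𝓞 L)ˣ) ^ 5 := by
      rcases Units.torsion_eq_one_or_neg_one_of_odd_finrank hodd ξ with h | h
      · simp [h]
      · rw [h, Odd.neg_one_pow (by decide)]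
    refine ⟨fun i ↦ ⟨(k i % 5).toNat, by omega⟩, ?_⟩
    dsimp only
    rw [QuotientGroup.eq]
    refine ⟨ξ * ∏ i, Units.fundSystem L i ^ (k i / 5), ?_⟩
    change (ξ * ∏ i, Units.fundSystem L i ^ (k i / 5) : (𝓞 L)ˣ) ^ 5 = _
    rw [eq_inv_mul_iff_mul_eq, hx, mul_pow, ← hξ, mul_left_comm, ← Finset.prod_pow,
      ← Finset.prod_mul_distrib]
    congr 1
    refine Finset.prod_congr rfl fun i _ ↦ ?_
    rw [← zpow_natCast, ← zpow_natCast, ← zpow_mul, ← zpow_add]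
    congr 1
    have := Int.toNat_of_nonneg (show 0 ≤ k i % 5 by omega)
    simp only [this]
    push_cast
    omega
  have : Finite ((𝓞 L)ˣ ⧸ P) := Finite.of_surjective _ hsurj
  have hcard : Nat.card ((𝓞 L)ˣ ⧸ P) ≤ Nat.card (Fin 4 → Fin 5) := by
    refine (Nat.card_le_card_of_surjective _ hsurj).trans ?_
    simp only [Nat.card_eq_fintype_card, Fintype.card_fun, Fintype.card_fin]
    exact Nat.pow_le_pow_right (by norm_num) hrank
  have hinj : Function.Injective (fun e : Fin 4 → Fin 5 ↦
      (QuotientGroup.mk (∏ i, u i ^ (e i : ℕ)) : (𝓞 L)ˣ ⧸ P)) := by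
    intro e e' h
    obtain ⟨x, hx⟩ := QuotientGroup.eq.1 h
    change x ^ 5 = _ at hx
    rw [eq_inv_mul_iff_mul_eq] at hx
    have hprod : ∏ j, u j ^ (4 * (e j : ℕ) + e' j) = (x * ∏ j, u j ^ (e j : ℕ)) ^ 5 := by
      simp only [pow_add, Finset.prod_mul_distrib, ← hx, pow_mul']
      rw [Finset.prod_pow, mul_pow, mul_comm (x ^ 5), ← mul_assoc, ← pow_succ]
    funext i
    have := hu _ _ hprod i
    omega
  obtain ⟨e, he⟩ := (hinj.bijective_of_nat_card_le hcard).2 (QuotientGroup.mk η)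
  obtain ⟨x, hx⟩ := QuotientGroup.eq.1 he
  change x ^ 5 = _ at hx
  rw [eq_inv_mul_iff_mul_eq] at hx
  exact ⟨e, x, hx.symm⟩

/-- The multiplication table of the integral basis `1, w, w ^ 2, μ, w * μ` of the quintic field. -/
structure IsQuinticPair {R : Type*} [CommRing R] (w μ : R) : Prop where
  cube : w ^ 3 = -16 + 12 * w + 2 * w ^ 2 + 3 * μ
  sq_mul : w ^ 2 * μ = -6 + 4 * μ - 2 * (w * μ)
  sq : μ ^ 2 = 8 - 2 * w

section Pair

variable {R : Type*} [CommRing R]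

/-- Four independent units of the quintic field. -/
def quinticUnit (w μ : R) : Fin 4 → R :=
  ![-3 + μ + w ^ 2, -5 - 3 * μ - 2 * w - w * μ,
    -1 + 4 * μ + 4 * w + w * μ + w ^ 2, -5 + 2 * μ + 3 * w - w * μ]

/-- The inverses of `quinticUnit`. -/
def quinticUnitInv (w μ : R) : Fin 4 → R :=
  ![605 + 161 * μ + 64 * w + 61 * w * μ - 47 * w ^ 2, -1 + μ - w * μ,
    -161 - 144 * μ + 450 * w + 172 * w * μ - 93 * w ^ 2,
    309 - 99 * μ + 5 * w - 26 * w * μ - 25 * w ^ 2]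

/-- A generator of the unramified prime above `11`. -/
def primeEleven (w μ : R) : R := 37 - 12 * μ - 3 * w * μ - 3 * w ^ 2

/-- The cofactor of `primeEleven` in `11`. -/
def coprimeEleven (w μ : R) : R := -25 - 12 * μ + 18 * w + 6 * w * μ - 3 * w ^ 2

/-- The leading coefficient of `linearFactor`, an element of norm `3`. -/
def leadCoeff (w : R) : R := 5 - w - w ^ 2

/-- The second coefficient of `linearFactor`. -/
def tailCoeff (w μ : R) : R := 46 - 9 * μ - 20 * w - w * μ - 10 * w ^ 2

/-- A linear factor of `quinticForm`. -/
def linearFactor (w μ X V : R) : R := X * leadCoeff w + V * tailCoeff w μ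

/-- The cofactor of `linearFactor` in `quinticForm`. -/
def quarticFactor (w μ X V : R) : R :=
  (-29 + 9 * μ + w + 3 * w * μ + 2 * w ^ 2) * X ^ 4 +
  (-392 + 123 * μ + 10 * w + 39 * w * μ + 28 * w ^ 2) * X ^ 3 * V +
  (-68 + 36 * μ - 38 * w - 10 * w * μ + 14 * w ^ 2) * X ^ 2 * V ^ 2 +
  (3044 - 984 * μ - 282 * w * μ - 236 * w ^ 2) * X * V ^ 3 +
  (2888 - 932 * μ + 56 * w - 240 * w * μ - 236 * w ^ 2) * V ^ 4

/-- A binary quintic form that splits off `linearFactor` over the quintic field. -/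
def quinticForm (X V : R) : R :=
  3 * X ^ 5 + 40 * X ^ 4 * V - 320 * X ^ 2 * V ^ 3 - 240 * X * V ^ 4 + 56 * V ^ 5

variable {w μ : R}

lemma IsQuinticPair.unit_mul_inv (h : IsQuinticPair w μ) (i : Fin 4) :
    quinticUnit w μ i * quinticUnitInv w μ i = 1 := by
  fin_cases i <;> simp [quinticUnit, quinticUnitInv]
  · linear_combination (-30 + 61 * μ - 47 * w) * h.cube + (236) * h.sq_mul + (344 + 61 * w) *
    h.sq
  · linear_combination (2 + μ) * h.sq_mul + (1) * h.sq
  · linear_combination (-108 + 79 * μ - 93 * w) * h.cube + (780 + 172 * μ) * h.sq_mul + (349 +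
    200 * w) * h.sq
  · linear_combination (-75 + 25 * μ) * h.cube + (-83 + 26 * μ) * h.sq_mul + (-19 - 5 * w) *
    h.sq

lemma IsQuinticPair.primeEleven_mul (h : IsQuinticPair w μ) :
    primeEleven w μ * coprimeEleven w μ = 11 := by
  rw [primeEleven, coprimeEleven]
  linear_combination (-36 - 9 * μ + 9 * w) * h.cube + (-18 * μ) * h.sq_mul + (45) * h.sq

lemma IsQuinticPair.leadCoeff_mul (h : IsQuinticPair w μ) :
    leadCoeff w * (-29 + 9 * μ + w + 3 * w * μ + 2 * w ^ 2) = 3 := by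
  rw [leadCoeff]
  linear_combination (-7 - 3 * μ - 2 * w) * h.cube + (-18) * h.sq_mul + (-9) * h.sq

lemma IsQuinticPair.linearFactor_mul (h : IsQuinticPair w μ) (X V : R) :
    linearFactor w μ X V * quarticFactor w μ X V = quinticForm X V := by
  rw [linearFactor, quarticFactor, quinticForm, leadCoeff, tailCoeff]
  linear_combination (8880 * V ^ 5 + 10092 * X * V ^ 4 + 528 * X ^ 2 * V ^ 3 - 1224 * X ^ 3 * V
    ^ 2 - 184 * X ^ 4 * V - 7 * X ^ 5 + 2636 * μ * V ^ 5 + 3296 * μ * X * V ^ 4 + 368 * μ * X ^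
    2 * V ^ 3 - 408 * μ * X ^ 3 * V ^ 2 - 71 * μ * X ^ 4 * V - 3 * μ * X ^ 5 + 2360 * w * V ^ 5
    + 2596 * w * X * V ^ 4 + 96 * w * X ^ 2 * V ^ 3 - 294 * w * X ^ 3 * V ^ 2 - 48 * w * X ^ 4 *
    V - 2 * w * X ^ 5) * h.cube + (21460 * V ^ 5 + 25368 * X * V ^ 4 + 1754 * X ^ 2 * V ^ 3 -
    3114 * X ^ 3 * V ^ 2 - 473 * X ^ 4 * V - 18 * X ^ 5 + 240 * μ * V ^ 5 + 282 * μ * X * V ^ 4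
    + 10 * μ * X ^ 2 * V ^ 3 - 39 * μ * X ^ 3 * V ^ 2 - 3 * μ * X ^ 4 * V) * h.sq_mul + (17256 *
    V ^ 5 + 19872 * X * V ^ 4 + 820 * X ^ 2 * V ^ 3 - 2487 * X ^ 3 * V ^ 2 - 306 * X ^ 4 * V - 9
    * X ^ 5 + 2612 * w * V ^ 5 + 2958 * w * X * V ^ 4 + 34 * w * X ^ 2 * V ^ 3 - 396 * w * X ^ 3
    * V ^ 2 - 30 * w * X ^ 4 * V) * h.sq

lemma IsQuinticPair.sq_tailCoeff_add (h : IsQuinticPair w μ) :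
    (2 * leadCoeff w + tailCoeff w μ) ^ 2 =
      coprimeEleven w μ * (2448 - 524 * μ - 1118 * w - 88 * w * μ - 572 * w ^ 2) := by
  rw [leadCoeff, tailCoeff, coprimeEleven]
  linear_combination (4326 + 3192 * μ - 1572 * w) * h.cube + (6500 + 529 * μ) * h.sq_mul + (5485
    + 1048 * w) * h.sq

lemma IsQuinticPair.quarticFactor_eight (h : IsQuinticPair w μ) :
    quarticFactor w μ 8 1 =
      4 + primeEleven w μ * (53820 + 61588 * μ - 197952 * w - 76084 * w * μ + 41952 * w ^ 2) := by
  rw [quarticFactor, primeEleven]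
  linear_combination (-342144 - 102396 * μ + 125856 * w) * h.cube + (-110460 - 228252 * μ) *
    h.sq_mul + (-481140 - 271740 * w) * h.sq

lemma IsQuinticPair.isCoprime_linearFactor (h : IsQuinticPair w μ) {X V : ℤ}
    (hXV : ¬ 11 ∣ X - 2 * V) : IsCoprime (linearFactor w μ X V) (coprimeEleven w μ) := by
  have h11 : (coprimeEleven w μ) ∣ ((11 : ℤ) : R) :=
    ⟨primeEleven w μ, by rw [mul_comm, h.primeEleven_mul]; norm_num⟩
  have hlead : IsCoprime (leadCoeff w) (coprimeEleven w μ) :=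
    ⟨4 * (-29 + 9 * μ + w + 3 * w * μ + 2 * w ^ 2), -primeEleven w μ, by
      linear_combination 4 * h.leadCoeff_mul - h.primeEleven_mul⟩
  have hcop : IsCoprime (((X - 2 * V : ℤ)) : R) (coprimeEleven w μ) :=
    ((((Int.prime_iff_natAbs_prime (k := 11)).2 (by norm_num)).coprime_iff_not_dvd.2
      hXV).symm.map (Int.castRingHom R)).of_isCoprime_of_dvd_right h11
  have hprod : IsCoprime ((leadCoeff w) ^ 2 * (((X - 2 * V : ℤ)) : R) ^ 2) (coprimeEleven w μ) :=
    hlead.pow_left.mul_left hcop.pow_left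
  refine IsCoprime.of_mul_left_left
    (y := leadCoeff w * (X - 2 * V) - (2 * leadCoeff w + tailCoeff w μ) * V) ?_
  have e : linearFactor w μ X V *
      (leadCoeff w * (X - 2 * V) - (2 * leadCoeff w + tailCoeff w μ) * V) =
      (leadCoeff w) ^ 2 * (((X - 2 * V : ℤ)) : R) ^ 2 + coprimeEleven w μ *
        (-(V : R) ^ 2 * (2448 - 524 * μ - 1118 * w - 88 * w * μ - 572 * w ^ 2)) := by
    push_cast
    rw [linearFactor]
    linear_combination (-(V : R) ^ 2) * h.sq_tailCoeff_add
  rw [e]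
  exact hprod.add_mul_left_left _

lemma IsQuinticPair.isCoprime_quarticFactor (h : IsQuinticPair w μ) {X V : ℤ}
    (hXV : 11 ∣ X - 8 * V) (hV : ¬ 11 ∣ V) :
    IsCoprime (quarticFactor w μ X V) (primeEleven w μ) := by
  have h11 : (primeEleven w μ) ∣ ((11 : ℤ) : R) :=
    ⟨coprimeEleven w μ, by rw [h.primeEleven_mul]; norm_num⟩
  obtain ⟨k, hk⟩ := hXV
  obtain rfl : X = 8 * V + 11 * k := by linarith
  have hcop : IsCoprime (((4 * V ^ 4 : ℤ)) : R) (primeEleven w μ) := by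
    have h11p : Prime (11 : ℤ) := Int.prime_iff_natAbs_prime.2 (by norm_num)
    refine (((h11p.coprime_iff_not_dvd).2 fun hd ↦ ?_).symm.map
      (Int.castRingHom R)).of_isCoprime_of_dvd_right h11
    rcases h11p.dvd_or_dvd hd with hd | hd
    · norm_num at hd
    · exact hV (h11p.dvd_of_dvd_pow hd)
  obtain ⟨r, hr⟩ : ∃ r, quarticFactor w μ ((8 * V + 11 * k : ℤ) : R) V =
      (V : R) ^ 4 * quarticFactor w μ 8 1 + 11 * r := by
    rw [quarticFactor, quarticFactor]
    push_cast
    generalize -29 + 9 * μ + w + 3 * w * μ + 2 * w ^ 2 = a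
    generalize -392 + 123 * μ + 10 * w + 39 * w * μ + 28 * w ^ 2 = b
    generalize -68 + 36 * μ - 38 * w - 10 * w * μ + 14 * w ^ 2 = c
    generalize 3044 - 984 * μ - 282 * w * μ - 236 * w ^ 2 = d
    generalize (V : R) = v
    generalize (k : R) = k
    refine ⟨a * (4 * (8 * v) ^ 3 * k + 6 * (8 * v) ^ 2 * (11 * k ^ 2) + 4 * (8 * v) * (121 * k ^ 3)
      + 1331 * k ^ 4) + b * v * (3 * (8 * v) ^ 2 * k + 3 * (8 * v) * (11 * k ^ 2) + 121 * k ^ 3)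
      + c * v ^ 2 * (2 * (8 * v) * k + 11 * k ^ 2) + d * v ^ 3 * k, ?_⟩
    ring
  rw [hr, h.quarticFactor_eight, ← h.primeEleven_mul]
  have e (x y : R) :
      (V : R) ^ 4 * (4 + primeEleven w μ * x) + primeEleven w μ * coprimeEleven w μ * y =
      ((4 * V ^ 4 : ℤ) : R) + primeEleven w μ * ((V : R) ^ 4 * x + coprimeEleven w μ * y) := by
    push_cast; ring
  rw [e]
  exact hcop.add_mul_left_left _

/-- If the form takes the value `± 11 ^ n`, then the linear factor is a unit times the `n`-th power
of `primeEleven`. -/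
lemma IsQuinticPair.exists_linearFactor_eq [IsDomain R] [CharZero R] (h : IsQuinticPair w μ)
    {X V : ℤ} {n : ℕ} (hform : quinticForm X V = 11 ^ n ∨ quinticForm X V = -11 ^ n)
    (hXV : ¬ 11 ∣ X - 2 * V) : ∃ η : Rˣ, linearFactor w μ X V = η * primeEleven w μ ^ n := by
  have hmul : linearFactor w μ X V * quarticFactor w μ X V = 11 ^ n ∨
      linearFactor w μ X V * quarticFactor w μ X V = -11 ^ n := by
    have hc : quinticForm (X : R) V = ((quinticForm X V : ℤ) : R) := by simp [quinticForm]
    rw [h.linearFactor_mul, hc]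
    rcases hform with e | e <;> simp [e]
  have hdvd : primeEleven w μ ^ n ∣ linearFactor w μ X V := by
    rcases Nat.eq_zero_or_pos n with rfl | hn
    · simp
    have h11p : Prime (11 : ℤ) := Int.prime_iff_natAbs_prime.2 (by norm_num)
    have hd : (11 : ℤ) ∣ quinticForm X V := by
      rcases hform with e | e <;> rw [e]
      · exact dvd_pow_self _ hn.ne'
      · exact (dvd_pow_self _ hn.ne').neg_right
    have hcong : (11 : ℤ) ∣ (X - 8 * V) * (X - 2 * V) ^ 4 := by
      have e : quinticForm X V = 3 * ((X - 8 * V) * (X - 2 * V) ^ 4) + 11 *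
          (8 * X ^ 4 * V - 24 * X ^ 3 * V ^ 2 + 32 * X ^ 2 * V ^ 3 - 96 * X * V ^ 4
            + 40 * V ^ 5) := by
        rw [quinticForm]; ring
      rw [e] at hd
      have := (dvd_add_left (dvd_mul_right (11 : ℤ) _)).1 hd
      exact (h11p.dvd_or_dvd this).resolve_left (by norm_num)
    have h8 : (11 : ℤ) ∣ X - 8 * V :=
      (h11p.dvd_or_dvd hcong).resolve_right fun hd ↦ hXV (h11p.dvd_of_dvd_pow hd)
    have hV : ¬ (11 : ℤ) ∣ V := fun hV ↦ hXV (by omega)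
    refine ((h.isCoprime_quarticFactor h8 hV).symm.pow_left (m := n)).dvd_of_dvd_mul_right
      (z := quarticFactor w μ X V) ?_
    rw [← h.primeEleven_mul, mul_pow] at hmul
    rcases hmul with e | e <;> rw [e]
    · exact dvd_mul_right _ _
    · exact (dvd_mul_right _ _).neg_right
  obtain ⟨η, hη⟩ := hdvd
  have hπ : primeEleven w μ ^ n ≠ 0 := by
    refine pow_ne_zero _ fun h0 ↦ ?_
    have := h.primeEleven_mul
    rw [h0, zero_mul] at this
    norm_num at this
  have hunit : IsUnit η := by
    refine IsCoprime.isUnit_of_dvd' (a := η) (b := coprimeEleven w μ ^ n)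
      (((hη ▸ h.isCoprime_linearFactor hXV).of_mul_left_right).pow_right) dvd_rfl ?_
    rw [← h.primeEleven_mul, mul_pow, hη] at hmul
    rcases hmul with e | e
    · exact ⟨quarticFactor w μ X V, (mul_left_cancel₀ hπ (by linear_combination -e))⟩
    · exact ⟨-quarticFactor w μ X V, (mul_left_cancel₀ hπ (by linear_combination e))⟩
  obtain ⟨η, rfl⟩ := hunit
  exact ⟨η, by rw [hη, mul_comm]⟩

end Pair

lemma IsQuinticPair.aeval_sub_one {R : Type*} [CommRing R] {w μ : R} (h : IsQuinticPair w μ) :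
    aeval (w - 1) quinticPoly = 0 := by
  rw [aeval_quinticPoly]
  linear_combination (-4 + 2 * w + w ^ 2) * h.cube + 3 * h.sq_mul

lemma isQuinticPair_of_aeval_eq_zero {K : Type*} [Field K] [CharZero K] {v : K}
    (hv : aeval v quinticPoly = 0) :
    IsQuinticPair (v + 1) ((16 - 12 * (v + 1) - 2 * (v + 1) ^ 2 + (v + 1) ^ 3) / 3) := by
  rw [aeval_quinticPoly] at hv
  refine ⟨?_, ?_, ?_⟩
  · field_simp
    ring
  · linear_combination (1 / 3) * hv
  · linear_combination ((v - 3) / 9) * hv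

lemma IsQuinticPair.isIntegral {R : Type*} [CommRing R] {w μ : R} (h : IsQuinticPair w μ) :
    IsIntegral ℤ μ := by
  refine ⟨X ^ 5 - C 20 * X ^ 3 + C 80 * X + C 24, by monicity!, ?_⟩
  simp only [eval₂_add, eval₂_sub, eval₂_mul, eval₂_pow, eval₂_X, eval₂_ofNat, map_ofNat]
  linear_combination (μ * (μ ^ 2 + 8 - 2 * w) - 20 * μ) * h.sq + 4 * h.sq_mul

lemma exists_isQuinticPair : ∃ (L : Type) (_ : Field L) (_ : NumberField L) (w μ : 𝓞 L),
    Module.finrank ℚ L = 5 ∧ IsQuinticPair w μ ∧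
    ∀ (S : Type) [CommRing S] (a b : S), IsQuinticPair a b → IsUnit (198 : S) →
      ∃ Φ : 𝓞 L →+* S, Φ w = a ∧ Φ μ = b := by
  obtain ⟨L, _, _, pb, hpb⟩ := exists_quinticField
  have hL := isQuinticPair_of_aeval_eq_zero hpb
  have hvint : IsIntegral ℤ pb.gen := ⟨quinticPoly, quinticPoly_monic, hpb⟩
  let v : 𝓞 L := ⟨pb.gen, hvint⟩
  let μ : 𝓞 L := ⟨_, hL.isIntegral⟩
  have hv : aeval v quinticPoly = 0 := by
    refine RingOfIntegers.ext ?_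
    have e : algebraMap (𝓞 L) L (aeval v quinticPoly) = aeval (v : L) quinticPoly :=
      (aeval_algebraMap_apply L v quinticPoly).symm
    exact e.trans hpb
  have hpair : IsQuinticPair (v + 1) μ :=
    ⟨RingOfIntegers.ext hL.cube, RingOfIntegers.ext hL.sq_mul, RingOfIntegers.ext hL.sq⟩
  refine ⟨L, inferInstance, inferInstance, v + 1, μ, finrank_eq_five pb hpb, hpair,
    fun S _ a b hab hunit ↦ ?_⟩
  obtain ⟨Φ, hΦ⟩ := exists_ringHom_of_root pb (v := v) rfl hv hab.aeval_sub_one hunit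
  have hw : Φ (v + 1) = a := by rw [map_add, hΦ, map_one, sub_add_cancel]
  refine ⟨Φ, hw, ?_⟩
  have h3 : IsUnit (3 : S) := isUnit_of_dvd_unit ⟨66, by norm_num⟩ hunit
  refine h3.mul_left_cancel ?_
  have := congrArg Φ hpair.cube
  simp only [map_add, map_mul, map_pow, hw, map_neg, map_ofNat] at this
  linear_combination this.symm.trans hab.cube

section Characters

variable {q : ℕ} [Fact q.Prime] {ζ : ZMod q}

lemma prod_mul_pow_five_pow {m : ℕ} (hq : 5 * m = q - 1) {a b : ZMod q} {c : Fin 4 → ℕ}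
    (hc : ∀ j, quinticUnit a b j ^ m = ζ ^ c j) (e : Fin 4 → ℕ) (z : ZMod q) {y : ZMod q}
    (hy : y ≠ 0) :
    ((∏ j, quinticUnit a b j ^ e j) * z * y ^ 5) ^ m = ζ ^ (∑ j, c j * e j) * z ^ m := by
  rw [mul_pow, mul_pow, ← pow_mul y, hq, ZMod.pow_card_sub_one_eq_one hy, mul_one,
    ← Finset.prod_pow, ← Finset.prod_pow_eq_pow_sum]
  congr 1
  refine Finset.prod_congr rfl fun j _ ↦ ?_
  rw [← pow_mul, mul_comm (e j), pow_mul, hc, pow_mul]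

lemma pow_eq_pow_of_mod_five_eq (hζ : ζ ^ 5 = 1) {m n : ℕ} (h : m % 5 = n % 5) :
    ζ ^ m = ζ ^ n := by
  rw [pow_eq_pow_mod m hζ, pow_eq_pow_mod n hζ, h]

lemma five_dvd_of_pow_eq_one (hζ : ζ ^ 5 = 1) (hζ1 : ζ ≠ 1) {n : ℕ} (h : ζ ^ n = 1) : 5 ∣ n := by
  have : Fact (Nat.Prime 5) := ⟨by norm_num⟩
  rw [← orderOf_eq_prime hζ hζ1]
  exact orderOf_dvd_of_pow_eq_one h

end Characters

lemma map_quinticUnit {R S : Type*} [CommRing R] [CommRing S] (Φ : R →+* S) (w μ : R) (j : Fin 4) :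
    Φ (quinticUnit w μ j) = quinticUnit (Φ w) (Φ μ) j := by
  fin_cases j <;>
    simp only [quinticUnit, Fin.zero_eta, Fin.mk_one, Fin.reduceFinMk, Matrix.cons_val,
      map_add, map_sub, map_mul, map_pow, map_neg, map_ofNat, map_one]

lemma map_primeEleven {R S : Type*} [CommRing R] [CommRing S] (Φ : R →+* S) (w μ : R) :
    Φ (primeEleven w μ) = primeEleven (Φ w) (Φ μ) := by
  simp only [primeEleven, map_sub, map_mul, map_pow, map_ofNat]

lemma map_linearFactor {R S : Type*} [CommRing R] [CommRing S] (Φ : R →+* S) (w μ X V : R) :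
    Φ (linearFactor w μ X V) = linearFactor (Φ w) (Φ μ) (Φ X) (Φ V) := by
  simp only [linearFactor, leadCoeff, tailCoeff, map_add, map_sub, map_mul, map_pow, map_ofNat]

/-- `quinticUnit` as units. -/
def IsQuinticPair.unit {R : Type*} [CommRing R] {w μ : R} (h : IsQuinticPair w μ) (j : Fin 4) :
    Rˣ where
  val := quinticUnit w μ j
  inv := quinticUnitInv w μ j
  val_inv := h.unit_mul_inv j
  inv_val := by rw [mul_comm]; exact h.unit_mul_inv j

instance : Fact (Nat.Prime 41) := ⟨by norm_num⟩
instance : Fact (Nat.Prime 181) := ⟨by norm_num⟩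

lemma dvd_sum_of_prod_unit_eq {R : Type*} [CommRing R] {w μ : R} (h : IsQuinticPair w μ)
    {q m : ℕ} [Fact q.Prime] (hq : 5 * m = q - 1) (Φ : R →+* ZMod q) {a b : ZMod q}
    (ha : Φ w = a) (hb : Φ μ = b) {ζ : ZMod q} (hζ : ζ ^ 5 = 1) (hζ1 : ζ ≠ 1) {c : Fin 4 → ℕ}
    (hc : ∀ j, quinticUnit a b j ^ m = ζ ^ c j) {e : Fin 4 → ℕ} {x : Rˣ}
    (he : ∏ j, h.unit j ^ e j = x ^ 5) : 5 ∣ ∑ j, c j * e j := by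
  have hx : Φ ↑x⁻¹ ≠ 0 := ((x⁻¹).isUnit.map Φ).ne_zero
  have hv : (1 : ZMod q) = (∏ j, quinticUnit a b j ^ e j) * (Φ ↑x⁻¹) ^ 5 := by
    have h1 : ((1 : Rˣ) : R) = ↑((∏ j, h.unit j ^ e j) * x⁻¹ ^ 5) := by
      rw [he, ← mul_pow, mul_inv_cancel, one_pow]
    have h2 := congrArg Φ h1
    rw [Units.val_one, map_one, Units.val_mul, map_mul, Units.coe_prod, map_prod,
      Units.val_pow_eq_pow_val, map_pow] at h2
    rw [h2]
    congr 1
    refine Finset.prod_congr rfl fun j _ ↦ ?_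
    rw [Units.val_pow_eq_pow_val, map_pow, ← ha, ← hb, ← map_quinticUnit]
    rfl
  refine five_dvd_of_pow_eq_one hζ hζ1 ?_
  rw [← mul_one (ζ ^ _), ← one_pow m, ← prod_mul_pow_five_pow hq hc e 1 hx, mul_one, ← hv]

lemma isQuinticPair_181 : IsQuinticPair (22 : ZMod 181) 67 ∧ IsQuinticPair (81 : ZMod 181) 82 ∧
    IsQuinticPair (111 : ZMod 181) 94 ∧ IsQuinticPair (154 : ZMod 181) 65 ∧
    IsQuinticPair (175 : ZMod 181) 54 := by
  refine ⟨⟨?_, ?_, ?_⟩, ⟨?_, ?_, ?_⟩, ⟨?_, ?_, ?_⟩, ⟨?_, ?_, ?_⟩, ⟨?_, ?_, ?_⟩⟩ <;> decide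

lemma isQuinticPair_41 : IsQuinticPair (22 : ZMod 41) 28 := by
  refine ⟨?_, ?_, ?_⟩ <;> decide

lemma quinticUnit_pow_181 :
    (∀ j, quinticUnit (22 : ZMod 181) 67 j ^ 36 = 59 ^ (![1, 1, 4, 3] j : ℕ)) ∧
    (∀ j, quinticUnit (81 : ZMod 181) 82 j ^ 36 = 59 ^ (![1, 2, 1, 1] j : ℕ)) ∧
    (∀ j, quinticUnit (111 : ZMod 181) 94 j ^ 36 = 59 ^ (![2, 1, 4, 1] j : ℕ)) ∧
    (∀ j, quinticUnit (154 : ZMod 181) 65 j ^ 36 = 59 ^ (![2, 3, 3, 2] j : ℕ)) ∧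
    (∀ j, quinticUnit (175 : ZMod 181) 54 j ^ 36 = 59 ^ (![4, 3, 3, 3] j : ℕ)) := by
  decide +kernel

lemma quinticUnit_pow_41 :
    ∀ j, quinticUnit (22 : ZMod 41) 28 j ^ 8 = 10 ^ (![3, 3, 1, 4] j : ℕ) := by
  decide +kernel

lemma primeEleven_pow_181 : primeEleven (22 : ZMod 181) 67 ^ 36 = 59 ^ 3 ∧
    primeEleven (81 : ZMod 181) 82 ^ 36 = 59 ^ 3 ∧ primeEleven (111 : ZMod 181) 94 ^ 36 = 59 ^ 3 ∧
    primeEleven (154 : ZMod 181) 65 ^ 36 = 59 ^ 3 ∧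
    primeEleven (175 : ZMod 181) 54 ^ 36 = 59 ^ 0 := by
  decide +kernel

lemma IsQuinticPair.five_dvd_of_prod_unit_eq {R : Type*} [CommRing R] {w μ : R}
    (h : IsQuinticPair w μ) (hom : ∀ (S : Type) [CommRing S] (a b : S), IsQuinticPair a b →
      IsUnit (198 : S) → ∃ Φ : R →+* S, Φ w = a ∧ Φ μ = b)
    {e : Fin 4 → ℕ} {x : Rˣ} (he : ∏ j, h.unit j ^ e j = x ^ 5) (i : Fin 4) : 5 ∣ e i := by
  have h181 : IsUnit (198 : ZMod 181) := isUnit_iff_ne_zero.2 (by decide)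
  have h41 : IsUnit (198 : ZMod 41) := isUnit_iff_ne_zero.2 (by decide)
  obtain ⟨Φ₀, ha₀, hb₀⟩ := hom _ _ _ isQuinticPair_41 h41
  obtain ⟨Φ₁, ha₁, hb₁⟩ := hom _ _ _ isQuinticPair_181.1 h181
  obtain ⟨Φ₂, ha₂, hb₂⟩ := hom _ _ _ isQuinticPair_181.2.1 h181
  obtain ⟨Φ₃, ha₃, hb₃⟩ := hom _ _ _ isQuinticPair_181.2.2.1 h181
  have hζ : (59 : ZMod 181) ^ 5 = 1 := by decide
  have hζ1 : (59 : ZMod 181) ≠ 1 := by decide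
  have d₀ := dvd_sum_of_prod_unit_eq h (m := 8) (by norm_num) Φ₀ ha₀ hb₀ (by decide) (by decide)
    quinticUnit_pow_41 he
  have d₁ := dvd_sum_of_prod_unit_eq h (m := 36) (by norm_num) Φ₁ ha₁ hb₁ hζ hζ1
    quinticUnit_pow_181.1 he
  have d₂ := dvd_sum_of_prod_unit_eq h (m := 36) (by norm_num) Φ₂ ha₂ hb₂ hζ hζ1
    quinticUnit_pow_181.2.1 he
  have d₃ := dvd_sum_of_prod_unit_eq h (m := 36) (by norm_num) Φ₃ ha₃ hb₃ hζ hζ1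
    quinticUnit_pow_181.2.2.1 he
  simp only [Fin.sum_univ_four, Matrix.cons_val] at d₀ d₁ d₂ d₃
  fin_cases i <;> simp only [Fin.zero_eta, Fin.mk_one, Fin.reduceFinMk] <;> omega

/-- The truncated polynomial ring `𝔽₅[τ] / (τ ^ 5)`, elements being given by their coefficients. -/
@[ext]
structure TruncatedPoly where
  c0 : ZMod 5
  c1 : ZMod 5
  c2 : ZMod 5
  c3 : ZMod 5
  c4 : ZMod 5

namespace TruncatedPoly

instance : DecidableEq TruncatedPoly := fun _ _ ↦ decidable_of_iff' _ TruncatedPoly.ext_iff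

instance : Zero TruncatedPoly := ⟨⟨0, 0, 0, 0, 0⟩⟩
instance : One TruncatedPoly := ⟨⟨1, 0, 0, 0, 0⟩⟩
instance : Add TruncatedPoly :=
  ⟨fun x y ↦ ⟨x.c0 + y.c0, x.c1 + y.c1, x.c2 + y.c2, x.c3 + y.c3, x.c4 + y.c4⟩⟩
instance : Neg TruncatedPoly := ⟨fun x ↦ ⟨-x.c0, -x.c1, -x.c2, -x.c3, -x.c4⟩⟩
instance : Mul TruncatedPoly :=
  ⟨fun x y ↦ ⟨x.c0 * y.c0, x.c0 * y.c1 + x.c1 * y.c0,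
    x.c0 * y.c2 + x.c1 * y.c1 + x.c2 * y.c0,
    x.c0 * y.c3 + x.c1 * y.c2 + x.c2 * y.c1 + x.c3 * y.c0,
    x.c0 * y.c4 + x.c1 * y.c3 + x.c2 * y.c2 + x.c3 * y.c1 + x.c4 * y.c0⟩⟩
instance : NatCast TruncatedPoly := ⟨fun n ↦ ⟨n, 0, 0, 0, 0⟩⟩

lemma zero_def : (0 : TruncatedPoly) = ⟨0, 0, 0, 0, 0⟩ := rfl
lemma one_def : (1 : TruncatedPoly) = ⟨1, 0, 0, 0, 0⟩ := rfl
lemma add_def (x y : TruncatedPoly) :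
    x + y = ⟨x.c0 + y.c0, x.c1 + y.c1, x.c2 + y.c2, x.c3 + y.c3, x.c4 + y.c4⟩ := rfl
lemma neg_def (x : TruncatedPoly) : -x = ⟨-x.c0, -x.c1, -x.c2, -x.c3, -x.c4⟩ := rfl
lemma mul_def (x y : TruncatedPoly) :
    x * y = ⟨x.c0 * y.c0, x.c0 * y.c1 + x.c1 * y.c0,
      x.c0 * y.c2 + x.c1 * y.c1 + x.c2 * y.c0,
      x.c0 * y.c3 + x.c1 * y.c2 + x.c2 * y.c1 + x.c3 * y.c0,
      x.c0 * y.c4 + x.c1 * y.c3 + x.c2 * y.c2 + x.c3 * y.c1 + x.c4 * y.c0⟩ := rfl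
lemma natCast_def (n : ℕ) : (n : TruncatedPoly) = ⟨n, 0, 0, 0, 0⟩ := rfl

instance : CommRing TruncatedPoly where
  add_assoc x y z := by ext <;> simp only [add_def] <;> ring
  zero_add x := by ext <;> simp only [add_def, zero_def] <;> ring
  add_zero x := by ext <;> simp only [add_def, zero_def] <;> ring
  add_comm x y := by ext <;> simp only [add_def] <;> ring
  neg_add_cancel x := by ext <;> simp only [add_def, neg_def, zero_def] <;> ring
  mul_assoc x y z := by ext <;> simp only [mul_def] <;> ring
  mul_comm x y := by ext <;> simp only [mul_def] <;> ring
  one_mul x := by ext <;> simp only [mul_def, one_def] <;> ring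
  mul_one x := by ext <;> simp only [mul_def, one_def] <;> ring
  zero_mul x := by ext <;> simp only [mul_def, zero_def] <;> ring
  mul_zero x := by ext <;> simp only [mul_def, zero_def] <;> ring
  left_distrib x y z := by ext <;> simp only [add_def, mul_def] <;> ring
  right_distrib x y z := by ext <;> simp only [add_def, mul_def] <;> ring
  natCast_zero := by ext <;> simp [natCast_def, zero_def]
  natCast_succ n := by ext <;> simp [natCast_def, add_def, one_def]
  nsmul := nsmulRec
  zsmul := zsmulRec

lemma pow_five (x : TruncatedPoly) : x ^ 5 = ⟨x.c0, 0, 0, 0, 0⟩ := by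
  have hx : x.c0 ^ 5 = x.c0 := by
    have : Fact (Nat.Prime 5) := ⟨by norm_num⟩
    exact ZMod.pow_card x.c0
  rw [pow_succ, pow_succ, pow_succ, pow_succ, pow_one]
  ext <;> simp only [mul_def] <;> ring_nf <;> reduce_mod_char
  exact hx

lemma isQuinticPair : IsQuinticPair (⟨1, 1, 0, 0, 0⟩ : TruncatedPoly) ⟨1, 4, 2, 2, 0⟩ := by
  refine ⟨?_, ?_, ?_⟩ <;> decide

/-- The condition for an element to lie in the span of the images of `leadCoeff` and
`tailCoeff`. -/
def IsLinear (x : TruncatedPoly) : Prop :=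
  x.c0 + x.c1 = 0 ∧ x.c3 + 4 * x.c4 = 0 ∧ x.c1 + 2 * x.c2 + 3 * x.c4 = 0

instance (x : TruncatedPoly) : Decidable x.IsLinear := inferInstanceAs (Decidable (_ ∧ _ ∧ _))

lemma isLinear_linearFactor (X V : ℤ) :
    (linearFactor (⟨1, 1, 0, 0, 0⟩ : TruncatedPoly) ⟨1, 4, 2, 2, 0⟩ X V).IsLinear := by
  have hlead : leadCoeff (⟨1, 1, 0, 0, 0⟩ : TruncatedPoly) = ⟨3, 2, 4, 0, 0⟩ := by decide
  have htail : tailCoeff (⟨1, 1, 0, 0, 0⟩ : TruncatedPoly) ⟨1, 4, 2, 2, 0⟩ = ⟨1, 4, 1, 3, 3⟩ := by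
    decide
  have hcast (n : ℤ) : (n : TruncatedPoly) = ⟨n, 0, 0, 0, 0⟩ := by
    have h : ∀ k : ℕ, ((-k : ℤ) : TruncatedPoly) = ⟨((-k : ℤ) : ZMod 5), 0, 0, 0, 0⟩ := fun k ↦ by
      rw [Int.cast_neg, Int.cast_natCast, natCast_def, neg_def]
      simp
    obtain ⟨k, rfl | rfl⟩ := n.eq_nat_or_neg
    · rw [Int.cast_natCast, natCast_def, Int.cast_natCast]
    · exact h k
  rw [linearFactor, hlead, htail, hcast, hcast]
  simp only [IsLinear, mul_def, add_def]
  refine ⟨?_, ?_, ?_⟩ <;> ring_nf <;> reduce_mod_char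

lemma IsLinear.of_mul_pow_five {g x : TruncatedPoly} (h : (g * x ^ 5).IsLinear)
    (hx : g * x ^ 5 ≠ 0) : g.IsLinear := by
  have : Fact (Nat.Prime 5) := ⟨by norm_num⟩
  rw [pow_five] at h hx
  have hx0 : x.c0 ≠ 0 := by
    rintro h0
    rw [h0] at hx
    exact hx (mul_zero g)
  simp only [IsLinear, mul_def, mul_zero, zero_add, add_zero] at h ⊢
  refine ⟨mul_right_cancel₀ hx0 ?_, mul_right_cancel₀ hx0 ?_, mul_right_cancel₀ hx0 ?_⟩
  · linear_combination h.1
  · linear_combination h.2.1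
  · linear_combination h.2.2

lemma exponents_of_isLinear : ∀ (e₀ e₂ k : Fin 5) (s : Fin 9),
    ((⟨4, 1, 3, 2, 0⟩ : TruncatedPoly) ^ (e₀ : ℕ) * ⟨4, 1, 3, 0, 3⟩ ^ (s : ℕ) *
      ⟨4, 2, 0, 2, 2⟩ ^ (e₂ : ℕ) * ⟨4, 1, 0, 4, 4⟩ ^ (k : ℕ)).IsLinear →
    (k : ℕ) = 1 ∧ (e₂ : ℕ) % 5 = (e₀ + 3) % 5 ∧ (s : ℕ) % 5 = (2 * e₀ + 4) % 5 := by
  decide +kernel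

end TruncatedPoly

/-- Relations between the quintic residue symbols modulo `181` of the conjugates of
`linearFactor`. -/
def ResidueRelations (X V : ZMod 181) : Prop :=
  linearFactor 81 82 X V ^ 36 = linearFactor 154 65 X V ^ 36 ∧
  linearFactor 111 94 X V ^ 36 = 59 ^ 3 * linearFactor 175 54 X V ^ 36 ∧
  (linearFactor 22 67 X V * linearFactor 111 94 X V ^ 2 * linearFactor 154 65 X V ^ 2) ^ 36 = 1

instance (X V : ZMod 181) : Decidable (ResidueRelations X V) :=
  inferInstanceAs (Decidable (_ ∧ _ ∧ _))

lemma not_residueRelations_one : ∀ t : ZMod 181, ¬ ResidueRelations 1 t := by decide +kernel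

lemma not_residueRelations_zero_one : ¬ ResidueRelations 0 1 := by decide +kernel

lemma ResidueRelations.of_mul {c X V : ZMod 181} (hc : c ≠ 0)
    (h : ResidueRelations (c * X) (c * V)) : ResidueRelations X V := by
  have hlin (a b : ZMod 181) : linearFactor a b (c * X) (c * V) = c * linearFactor a b X V := by
    rw [linearFactor, linearFactor]; ring
  obtain ⟨h1, h2, h3⟩ := h
  rw [hlin, hlin, mul_pow, mul_pow] at h1 h2
  have hc' := pow_ne_zero 36 hc
  refine ⟨mul_left_cancel₀ hc' h1, mul_left_cancel₀ hc' (h2.trans (mul_left_comm _ _ _)), ?_⟩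
  rw [hlin, hlin, hlin] at h3
  have hc1 : c ^ 180 = 1 := ZMod.pow_card_sub_one_eq_one hc
  rw [← h3, ← one_mul (_ ^ 36), ← hc1]
  ring

lemma not_residueRelations (X V : ZMod 181) : ¬ ResidueRelations X V := by
  intro h
  by_cases hX : X = 0
  · by_cases hV : V = 0
    · rw [hX, hV] at h
      revert h
      decide +kernel
    · refine not_residueRelations_zero_one (ResidueRelations.of_mul hV ?_)
      rwa [mul_zero, mul_one, ← hX]
  · refine not_residueRelations_one (X⁻¹ * V) (ResidueRelations.of_mul hX ?_)
    rwa [mul_one, mul_inv_cancel_left₀ hX]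

/-- The form does not take values `± 11 ^ n` outside of a residue class modulo `11`. -/
lemma not_quinticForm_eq_pow {X V : ℤ} {n : ℕ} (hXV : ¬ 11 ∣ X - 2 * V)
    (hform : quinticForm X V = 11 ^ n ∨ quinticForm X V = -11 ^ n) : False := by
  obtain ⟨L, _, _, w, μ, hfin, h, hom⟩ := exists_isQuinticPair
  obtain ⟨η, hη⟩ := h.exists_linearFactor_eq hform hXV
  obtain ⟨e, x, rfl⟩ := exists_eq_prod_mul_pow_five hfin h.unit
    (fun _ _ he i ↦ h.five_dvd_of_prod_unit_eq hom he i) η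
  have hξ : linearFactor w μ X V = (∏ j, quinticUnit w μ j ^ (e j : ℕ)) *
      primeEleven w μ ^ (n % 5) * (x * primeEleven w μ ^ (n / 5)) ^ 5 := by
    rw [hη, mul_pow, ← pow_mul, Units.val_mul, Units.coe_prod, Units.val_pow_eq_pow_val]
    nth_rw 1 [← Nat.mod_add_div n 5]
    rw [pow_add, mul_comm 5 (n / 5)]
    simp only [Units.val_pow_eq_pow_val, IsQuinticPair.unit]
    ring
  set y := (x : 𝓞 L) * primeEleven w μ ^ (n / 5)
  have hmap {S : Type} [CommRing S] {a b : S} (hab : IsQuinticPair a b) (hu : IsUnit (198 : S)) :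
      ∃ z, linearFactor a b X V = (∏ j, quinticUnit a b j ^ (e j : ℕ)) *
        primeEleven a b ^ (n % 5) * z ^ 5 := by
    obtain ⟨Φ, rfl, rfl⟩ := hom S a b hab hu
    refine ⟨Φ y, ?_⟩
    have := congrArg Φ hξ
    rw [map_linearFactor, map_intCast, map_intCast] at this
    simpa only [map_mul, map_pow, map_prod, map_quinticUnit, map_primeEleven] using this
  have hne {S : Type} [CommRing S] [Nontrivial S] {a b : S} (hab : IsQuinticPair a b)
      (hu : IsUnit (11 : S)) : linearFactor a b X V ≠ 0 := by
    intro h0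
    have h1 := hab.linearFactor_mul X V
    rw [h0, zero_mul] at h1
    have h2 : (0 : S) = ((quinticForm X V : ℤ) : S) := by simpa [quinticForm] using h1
    refine (hu.pow n).ne_zero ?_
    rcases hform with hf | hf <;> rw [hf] at h2
    · simpa using h2.symm
    · simpa using h2.symm
  have hexp : n % 5 = 1 ∧ (e 2 : ℕ) % 5 = (e 0 + 3) % 5 ∧
      (e 1 + e 3 : ℕ) % 5 = (2 * e 0 + 4) % 5 := by
    have : Nontrivial TruncatedPoly := ⟨0, 1, by decide⟩
    have hT := TruncatedPoly.isQuinticPair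
    obtain ⟨z, hz⟩ := hmap hT (IsUnit.of_mul_eq_one 2 (by decide))
    have hlin := TruncatedPoly.isLinear_linearFactor X V
    have hz0 := hne hT (IsUnit.of_mul_eq_one 1 (by decide))
    rw [hz] at hlin hz0
    have := hlin.of_mul_pow_five hz0
    have key := TruncatedPoly.exponents_of_isLinear (e 0) (e 2) ⟨n % 5, Nat.mod_lt _ (by norm_num)⟩
      ⟨e 1 + e 3, by omega⟩
    refine key ?_
    convert this using 1
    rw [Fin.prod_univ_four, show primeEleven (⟨1, 1, 0, 0, 0⟩ : TruncatedPoly) ⟨1, 4, 2, 2, 0⟩ =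
      ⟨4, 1, 0, 4, 4⟩ by decide, show quinticUnit (⟨1, 1, 0, 0, 0⟩ : TruncatedPoly)
      ⟨1, 4, 2, 2, 0⟩ 0 = ⟨4, 1, 3, 2, 0⟩ by decide,
      show quinticUnit (⟨1, 1, 0, 0, 0⟩ : TruncatedPoly)
      ⟨1, 4, 2, 2, 0⟩ 1 = ⟨4, 1, 3, 0, 3⟩ by decide,
      show quinticUnit (⟨1, 1, 0, 0, 0⟩ : TruncatedPoly)
      ⟨1, 4, 2, 2, 0⟩ 2 = ⟨4, 2, 0, 2, 2⟩ by decide,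
      show quinticUnit (⟨1, 1, 0, 0, 0⟩ : TruncatedPoly)
      ⟨1, 4, 2, 2, 0⟩ 3 = ⟨4, 1, 3, 0, 3⟩ by decide]
    dsimp only
    rw [pow_add]
    ring
  obtain ⟨hn, he2, he3⟩ := hexp
  have hlog {a b : ZMod 181} (hab : IsQuinticPair a b) {c : Fin 4 → ℕ}
      (hc : ∀ j, quinticUnit a b j ^ 36 = 59 ^ c j) {d : ℕ} (hd : primeEleven a b ^ 36 = 59 ^ d) :
      linearFactor a b (X : ZMod 181) V ^ 36 = 59 ^ (∑ j, c j * e j + d) := by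
    obtain ⟨z, hz⟩ := hmap hab (isUnit_iff_ne_zero.2 (by decide))
    have hz0 := hne hab (isUnit_iff_ne_zero.2 (by decide))
    have hzne : z ≠ 0 := by
      rintro rfl
      rw [hz] at hz0
      simp at hz0
    rw [hz, prod_mul_pow_five_pow (by norm_num) hc _ _ hzne, hn, pow_one, hd, pow_add]
  have hζ : (59 : ZMod 181) ^ 5 = 1 := by decide
  obtain ⟨p0, p1, p2, p3, p4⟩ := isQuinticPair_181
  obtain ⟨u0, u1, u2, u3, u4⟩ := quinticUnit_pow_181
  obtain ⟨q0, q1, q2, q3, q4⟩ := primeEleven_pow_181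
  have l0 := hlog p0 u0 q0
  have l1 := hlog p1 u1 q1
  have l2 := hlog p2 u2 q2
  have l3 := hlog p3 u3 q3
  have l4 := hlog p4 u4 q4
  simp only [Fin.sum_univ_four, Matrix.cons_val] at l0 l1 l2 l3 l4
  refine not_residueRelations X V ⟨?_, ?_, ?_⟩
  · rw [l1, l3]
    exact pow_eq_pow_of_mod_five_eq hζ (by omega)
  · rw [l2, l4, ← pow_add]
    exact pow_eq_pow_of_mod_five_eq hζ (by omega)
  · rw [mul_pow, mul_pow, pow_right_comm _ 2, pow_right_comm _ 2, l0, l2, l3, ← pow_mul, ← pow_mul,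
      ← pow_add, ← pow_add]
    exact (pow_eq_pow_of_mod_five_eq hζ (n := 0) (by omega)).trans (pow_zero _)

/-- The ring of integers of `ℚ(√-55)`. -/
abbrev QuadraticOrder : Type := QuadraticAlgebra ℤ (-14) 1

/-- Every positive definite binary quadratic form of discriminant `-55` represents `1`, `2` or
`4`. -/
lemma exists_form_eq_one_or_two_or_four (A B C : ℤ) (hA : 0 < A) (hdisc : B ^ 2 - 4 * A * C = -55) :
    ∃ p q j : ℤ, A * p ^ 2 + B * p * q + C * q ^ 2 = j ∧ (j = 1 ∨ j = 2 ∨ j = 4) := by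
  induction hn : A.toNat using Nat.strong_induction_on generalizing A B C with
  | _ n ih =>
    by_cases hsmall : A < 5
    · have h3 : A ≠ 3 := by
        rintro rfl
        have : B ^ 2 % 3 = 2 := by omega
        rcases (by omega : B % 3 = 0 ∨ B % 3 = 1 ∨ B % 3 = 2) with h | h | h <;>
          simp [pow_two, Int.mul_emod, h] at this
      exact ⟨1, 0, A, by ring, by omega⟩
    · have hA5 : 5 ≤ A := not_lt.1 hsmall
      set k := -((B + A) / (2 * A)) with hk
      set B' := B + 2 * A * k with hB'
      set C' := A * k ^ 2 + B * k + C with hC'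
      have hB1 : -A ≤ B' ∧ B' < A := by
        have h1 := Int.emod_nonneg (B + A) (by omega : 2 * A ≠ 0)
        have h2 := Int.emod_lt_of_pos (B + A) (by omega : 0 < 2 * A)
        have h3 := Int.emod_add_mul_ediv (B + A) (2 * A)
        have : B' = (B + A) % (2 * A) - A := by rw [hB', hk]; linarith
        omega
      have hd' : B' ^ 2 - 4 * C' * A = -55 := by rw [hB', hC']; linear_combination hdisc
      have hsq : B' ^ 2 ≤ A ^ 2 := by nlinarith
      have hC0 : 0 < C' := by nlinarith [sq_nonneg B']
      have hCA : C' < A := by nlinarith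
      obtain ⟨p, q, j, hj, hj'⟩ := ih C'.toNat (by omega) C' B' A hC0 hd' rfl
      refine ⟨q + k * p, p, j, ?_, hj'⟩
      rw [← hj, hB', hC']
      ring

lemma norm_quadraticOrder (u : QuadraticOrder) :
    u.norm = u.re ^ 2 + u.re * u.im + 14 * u.im ^ 2 := by
  rw [QuadraticAlgebra.norm_def]; ring

lemma exists_pow_five_eq_mul {x y z : ℤ} (hx : Odd x) (hz : Odd z) (hy : 0 < y)
    (hzy : IsCoprime z y) (h : x ^ 2 + 55 * z ^ 2 = y ^ 5) {r : ℤ} (hr : x = 2 * r + z) :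
    ∃ (B κ : QuadraticOrder) (j : ℤ), B ^ 5 = ⟨r, z⟩ * κ ∧ κ.norm = 4 * j ^ 5 ∧
      (j = 1 ∨ j = 2 ∨ j = 4) := by
  have hy2 : Even y := by
    have : Even (y ^ 5) := by
      rw [← h]
      exact (hx.pow).add_odd (Odd.mul (by decide) hz.pow)
    exact (Int.even_pow.1 this).1
  obtain ⟨y', hy'⟩ := hy2.two_dvd
  obtain ⟨u, v, huv⟩ := hzy.pow_right (n := 5)
  set c := u * x with hc
  have hcz : c * z = x + y ^ 5 * (-(x * v)) := by rw [hc]; linear_combination x * huv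
  set g := -(x * v) with hg
  have hcodd : Odd c := by
    have h1 : Odd (c * z) := by
      rw [hcz]
      refine hx.add_even ?_
      rw [hy']
      exact ((even_two_mul y').pow_of_ne_zero (by norm_num)).mul_right _
    exact (Int.odd_mul.1 h1).1
  obtain ⟨d, hd⟩ := hcodd
  have hcdvd : y ^ 5 ∣ c ^ 2 + 55 := by
    refine (hzy.symm.pow (m := 5) (n := 2)).dvd_of_dvd_mul_left ?_
    refine ⟨1 + 2 * x * g + y ^ 5 * g ^ 2, ?_⟩
    linear_combination (c * z + x + y ^ 5 * g) * hcz + h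
  obtain ⟨m, hm⟩ : 4 * y ∣ c ^ 2 + 55 :=
    Dvd.dvd.trans ⟨4 * y' ^ 4, by rw [hy']; ring⟩ hcdvd
  obtain ⟨p, q, j, hj, hj'⟩ := exists_form_eq_one_or_two_or_four y c m hy (by linear_combination hm)
  have hαnorm : 4 * (⟨r, z⟩ : QuadraticOrder).norm = y ^ 5 := by
    rw [norm_quadraticOrder, ← h, hr]; ring
  set α : QuadraticOrder := ⟨r, z⟩ with hα
  set B : QuadraticOrder := ⟨p * y + q * d, q⟩ with hB
  have hBnorm : B.norm = y * j := by
    rw [norm_quadraticOrder, ← hj, hB]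
    simp only
    refine mul_left_cancel₀ (four_ne_zero (α := ℤ)) ?_
    rw [hd] at hm ⊢
    linear_combination q ^ 2 * hm
  have hαy : α * (4 * star α) = (y : QuadraticOrder) ^ 5 := by
    have := QuadraticAlgebra.algebraMap_norm_eq_mul_star α
    rw [mul_left_comm, ← this, eq_intCast]
    exact_mod_cast congrArg (Int.cast : ℤ → QuadraticOrder) hαnorm
  have hzB : (z : QuadraticOrder) * B = p * z * y + α * (q * (1 + 2 * star α * g)) := by
    have h1 : (z : QuadraticOrder) * B = p * z * y + q * (α + 2 * (α * star α) * g) := by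
      rw [← QuadraticAlgebra.algebraMap_norm_eq_mul_star α, eq_intCast]
      have h2 : 2 * (z * d) = 2 * (r + 2 * α.norm * g) := by
        rw [hd, hr, ← hαnorm] at hcz
        linear_combination hcz
      have h3 := mul_left_cancel₀ two_ne_zero h2
      ext
      · simp only [hB, hα, QuadraticAlgebra.re_mul, QuadraticAlgebra.im_mul,
          QuadraticAlgebra.re_add, QuadraticAlgebra.im_add, QuadraticAlgebra.re_intCast,
          QuadraticAlgebra.im_intCast, QuadraticAlgebra.re_ofNat, QuadraticAlgebra.im_ofNat,
          Int.cast_id]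
        rw [← hα]
        linear_combination q * h3
      · simp only [hB, hα, QuadraticAlgebra.re_mul, QuadraticAlgebra.im_mul,
          QuadraticAlgebra.re_add, QuadraticAlgebra.im_add, QuadraticAlgebra.re_intCast,
          QuadraticAlgebra.im_intCast, QuadraticAlgebra.re_ofNat, QuadraticAlgebra.im_ofNat,
          Int.cast_id]
        ring
    rw [h1]; ring
  have hdvd : α ∣ B ^ 5 := by
    have hcop : IsCoprime α ((z : QuadraticOrder) ^ 5) := by
      have : IsCoprime ((y : QuadraticOrder) ^ 5) ((z : QuadraticOrder) ^ 5) := by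
        exact_mod_cast ((hzy.symm.pow (m := 5) (n := 5)).map (Int.castRingHom QuadraticOrder))
      exact this.of_isCoprime_of_dvd_left ⟨_, hαy.symm⟩
    refine hcop.dvd_of_dvd_mul_left ?_
    rw [← mul_pow, hzB]
    have h1 := sub_dvd_pow_sub_pow
      (p * z * y + α * (q * (1 + 2 * star α * g)) : QuadraticOrder) (p * z * y) 5
    rw [add_sub_cancel_left] at h1
    refine (dvd_sub_left (c := (p * z * y : QuadraticOrder) ^ 5) ?_).1
      ((dvd_mul_right _ _).trans h1)
    rw [mul_pow, ← hαy]
    exact (dvd_mul_right _ _).mul_left _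
  obtain ⟨κ, hκ⟩ := hdvd
  refine ⟨B, κ, j, hκ, ?_, hj'⟩
  have h1 := congrArg QuadraticAlgebra.norm hκ
  rw [map_pow, map_mul, hBnorm] at h1
  refine mul_left_cancel₀ (pow_pos hy 5).ne' ?_
  linear_combination -4 * h1 - κ.norm * hαnorm

lemma eq_of_norm_eq {κ : QuadraticOrder} {j : ℤ} (hκ : κ.norm = 4 * j ^ 5)
    (hj : j = 1 ∨ j = 2 ∨ j = 4) :
    ∃ η : QuadraticOrder, (κ = η ∨ κ = -η) ∧ (η = ⟨2, 0⟩ ∨ η = ⟨64, 0⟩ ∨ η = ⟨16, 16⟩ ∨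
      η = ⟨32, -16⟩ ∨ η = ⟨-40, -12⟩ ∨ η = ⟨-55, -7⟩ ∨ η = ⟨-52, 12⟩ ∨ η = ⟨-62, 7⟩) := by
  obtain ⟨r, i⟩ := κ
  rw [norm_quadraticOrder] at hκ
  simp only at hκ
  have hle : r ^ 2 + r * i + 14 * i ^ 2 ≤ 4096 := by
    rcases hj with rfl | rfl | rfl <;> norm_num at hκ <;> omega
  have hi : -17 ≤ i ∧ i ≤ 17 := by
    constructor <;> nlinarith [sq_nonneg (2 * r + i)]
  have hr : -70 ≤ r ∧ r ≤ 70 := by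
    constructor <;> nlinarith [sq_nonneg (28 * i + r)]
  have key : ∀ i ∈ Finset.Icc (-17 : ℤ) 17, ∀ r ∈ Finset.Icc (-70 : ℤ) 70,
      (r ^ 2 + r * i + 14 * i ^ 2 = 4 ∨ r ^ 2 + r * i + 14 * i ^ 2 = 128 ∨
        r ^ 2 + r * i + 14 * i ^ 2 = 4096) →
      ((r, i) ∈ [((2 : ℤ), (0 : ℤ)), (64, 0), (16, 16), (32, -16), (-40, -12), (-55, -7),
        (-52, 12), (-62, 7)] ∨ (-r, -i) ∈ [((2 : ℤ), (0 : ℤ)), (64, 0), (16, 16), (32, -16),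
        (-40, -12), (-55, -7), (-52, 12), (-62, 7)]) := by
    decide +kernel
  have := key i (Finset.mem_Icc.2 hi) r (Finset.mem_Icc.2 hr) (by
    rcases hj with rfl | rfl | rfl <;> norm_num at hκ <;> simp [hκ])
  rcases this with h | h
  · refine ⟨⟨r, i⟩, Or.inl rfl, ?_⟩
    simpa [QuadraticAlgebra.ext_iff] using h
  · refine ⟨⟨-r, -i⟩, Or.inr (by simp), ?_⟩
    simpa [QuadraticAlgebra.ext_iff] using h

/-- Evaluation at a root of `t ^ 2 - t + 14` modulo `N`. -/
lemma dvd_pow_five_sub_mul {N t : ℤ} (ht : N ∣ t ^ 2 - t + 14) {B α κ : QuadraticOrder}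
    (h : B ^ 5 = α * κ) :
    N ∣ (B.re + B.im * t) ^ 5 - (α.re + α.im * t) * (κ.re + κ.im * t) := by
  rw [← Ideal.mem_span_singleton, ← Ideal.Quotient.eq_zero_iff_mem]
  set f := Ideal.Quotient.mk (Ideal.span {N})
  have ht' : f t * f t = (-14 : ℤ) • 1 + (1 : ℤ) • f t := by
    have : f (t ^ 2 - t + 14) = 0 :=
      Ideal.Quotient.eq_zero_iff_mem.2 (Ideal.mem_span_singleton.2 ht)
    simp only [map_add, map_sub, map_pow, map_ofNat] at this
    simp only [zsmul_eq_mul]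
    push_cast
    linear_combination this
  have hφ (z : QuadraticOrder) : QuadraticAlgebra.lift ⟨f t, ht'⟩ z = f (z.re + z.im * t) := by
    rw [QuadraticAlgebra.lift_apply_apply]
    simp
  have := congrArg (QuadraticAlgebra.lift ⟨f t, ht'⟩) h
  rw [map_pow, map_mul, hφ, hφ, hφ] at this
  rw [map_sub, map_pow, map_mul, this, sub_self]

lemma five_dvd_of_dvd_pow_five_sub {b a : ℤ} {v : ℕ} (hv : v < 13) (ha : Odd a)
    (h : 2 ^ 13 ∣ b ^ 5 - 2 ^ v * a) : 5 ∣ v := by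
  obtain ⟨k, hk⟩ := h
  have hb : b ^ 5 = 2 ^ v * (a + 2 * (2 ^ (12 - v) * k)) := by
    have : (2 : ℤ) ^ 13 = 2 ^ v * (2 * 2 ^ (12 - v)) := by
      rw [← pow_succ', ← pow_add]; congr 1; omega
    rw [this] at hk
    linear_combination hk
  have hodd : Odd (a + 2 * (2 ^ (12 - v) * k)) := ha.add_even (even_two_mul _)
  have h2 : Prime (2 : ℤ) := Int.prime_two
  have hemul := congrArg (emultiplicity 2) hb
  rw [emultiplicity_mul h2, emultiplicity_pow h2, emultiplicity_pow_self_of_prime h2,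
    emultiplicity_eq_zero.2 (fun hd ↦ (Int.not_even_iff_odd.2 hodd) (even_iff_two_dvd.2 hd)),
    add_zero] at hemul
  have hb0 : b ≠ 0 := by
    rintro rfl
    have : Even (a + 2 * (2 ^ (12 - v) * k)) := by
      have h0 : (2 : ℤ) ^ v * (a + 2 * (2 ^ (12 - v) * k)) = 0 := by rw [← hb]; norm_num
      rw [(mul_eq_zero.1 h0).resolve_left (by positivity)]
      exact Even.zero
    exact (Int.not_even_iff_odd.2 hodd) this
  have hfin : FiniteMultiplicity (2 : ℤ) b := Int.finiteMultiplicity_iff.2 ⟨by norm_num, hb0⟩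
  rw [hfin.emultiplicity_eq_multiplicity] at hemul
  exact ⟨_, by exact_mod_cast hemul.symm⟩

lemma four_dvd_of_dvd_pow_five {b : ℤ} (h : 64 ∣ b ^ 5) : 4 ∣ b := by
  have h2 : Prime (2 : ℤ) := Int.prime_two
  obtain ⟨c, rfl⟩ := h2.dvd_of_dvd_pow ((by norm_num : (2 : ℤ) ∣ 64).trans h)
  have hc : (2 : ℤ) ∣ c ^ 5 := by
    rw [mul_pow] at h
    omega
  obtain ⟨d, rfl⟩ := h2.dvd_of_dvd_pow hc
  exact ⟨d, by ring⟩

/-- The even part of the class of a fifth root of an ideal can be made explicit. -/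
lemma exists_pow_five_eq {r z j : ℤ} (hodd : Odd (r + z)) {B κ : QuadraticOrder}
    (hB : B ^ 5 = ⟨r, z⟩ * κ) (hκ : κ.norm = 4 * j ^ 5) (hj : j = 1 ∨ j = 2 ∨ j = 4) :
    ∃ C : QuadraticOrder, C ^ 5 = ⟨r, z⟩ * ⟨-52, 12⟩ := by
  obtain ⟨η, hη, hcases⟩ := eq_of_norm_eq hκ hj
  obtain ⟨B, hB⟩ : ∃ B : QuadraticOrder, B ^ 5 = ⟨r, z⟩ * η := by
    rcases hη with rfl | rfl
    · exact ⟨B, hB⟩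
    · exact ⟨-B, by rw [Odd.neg_pow (by decide), hB, mul_neg, neg_neg]⟩
  have hval (v : ℕ) (a : ℤ) (hv : v < 13) (h5 : ¬ 5 ∣ v) (ha : Odd a)
      (h : η.re + η.im * 7599 = 2 ^ v * a) : False := by
    refine h5 (five_dvd_of_dvd_pow_five_sub (b := B.re + B.im * 7599) (a := (r + z * 7599) * a)
      hv (Odd.mul ?_ ha) ?_)
    · rw [show r + z * 7599 = r + z + 2 * (3799 * z) by ring]
      exact hodd.add_even (even_two_mul _)
    · have := dvd_pow_five_sub_mul (N := 2 ^ 13) (t := 7599) (by norm_num) hB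
      rw [h] at this
      rwa [mul_left_comm]
  rcases hcases with rfl | rfl | rfl | rfl | rfl | rfl | rfl | rfl
  · exact (hval 1 1 (by norm_num) (by norm_num) (by decide) (by norm_num)).elim
  · exact (hval 6 1 (by norm_num) (by norm_num) (by decide) (by norm_num)).elim
  · exact (hval 8 475 (by norm_num) (by norm_num) (by decide) (by norm_num)).elim
  · exact (hval 4 (-7597) (by norm_num) (by norm_num) (by decide) (by norm_num)).elim
  · exact (hval 2 (-22807) (by norm_num) (by norm_num) (by decide) (by norm_num)).elim
  · exact (hval 12 (-13) (by norm_num) (by norm_num) (by decide) (by norm_num)).elim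
  · exact ⟨B, hB⟩
  · have h4 : 4 ∣ B.re + B.im * 18 := by
      refine four_dvd_of_dvd_pow_five ?_
      have := dvd_pow_five_sub_mul (N := 64) (t := 18) (by norm_num) hB
      refine (dvd_sub_left ?_).1 this
      exact (by norm_num : (64 : ℤ) ∣ -62 + 7 * 18).mul_left _
    obtain ⟨k, hk⟩ := h4
    let C : QuadraticOrder := ⟨k - 8 * B.im, k - 4 * B.im⟩
    have hC : (4 : QuadraticOrder) * C = B * ⟨1, 1⟩ := by
      ext
      · simp [C, QuadraticAlgebra.re_ofNat, QuadraticAlgebra.im_ofNat]; linarith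
      · simp [C, QuadraticAlgebra.re_ofNat, QuadraticAlgebra.im_ofNat]; linarith
    refine ⟨C, smul_right_injective QuadraticOrder (show (1024 : ℤ) ≠ 0 by norm_num) ?_⟩
    have h1 : (⟨-62, 7⟩ : QuadraticOrder) * ⟨1, 1⟩ ^ 5 = 1024 * ⟨-52, 12⟩ := by
      ext <;> simp [pow_succ, QuadraticAlgebra.re_ofNat, QuadraticAlgebra.im_ofNat]
    have h2 : (4 * C) ^ 5 = ⟨r, z⟩ * (1024 * ⟨-52, 12⟩) := by
      rw [hC, mul_pow, hB, mul_assoc, h1]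
    simp only [zsmul_eq_mul]
    push_cast
    linear_combination h2

lemma exists_eq_quinticForm_of_odd {x y z : ℤ} (hx : Odd x) (hz : Odd z) (hy : 0 < y)
    (hzy : IsCoprime z y) (h : x ^ 2 + 55 * z ^ 2 = y ^ 5) {r : ℤ} (hr : x = 2 * r + z)
    (hodd : Odd (r + z)) :
    ∃ X V : ℤ, y = 4 * X ^ 2 + 6 * X * V + 16 * V ^ 2 ∧ z = -quinticForm X V := by
  obtain ⟨B, κ, j, hB, hκ, hj⟩ := exists_pow_five_eq_mul hx hz hy hzy h hr
  obtain ⟨C, hC⟩ := exists_pow_five_eq hodd hB hκ hj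
  have h4 : 4 ∣ C.re + C.im * (-17) := by
    refine four_dvd_of_dvd_pow_five ?_
    have := dvd_pow_five_sub_mul (N := 64) (t := -17) (by norm_num) hC
    refine (dvd_sub_left ?_).1 this
    exact (by norm_num : (64 : ℤ) ∣ -52 + 12 * (-17)).mul_left _
  have h2 : 2 ∣ C.re + C.im * 18 := by
    refine Int.prime_two.dvd_of_dvd_pow (n := 5) ?_
    have := dvd_pow_five_sub_mul (N := 2) (t := 18) (by norm_num) hC
    refine (dvd_sub_left ?_).1 this
    exact (by norm_num : (2 : ℤ) ∣ -52 + 12 * 18).mul_left _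
  obtain ⟨V, hV⟩ : 2 ∣ C.im := by omega
  obtain ⟨X, hX⟩ : 4 ∣ C.re - C.im := by omega
  obtain rfl : C = ⟨4 * X + 2 * V, 2 * V⟩ := by
    ext
    · simp only; omega
    · exact hV
  refine ⟨X, V, ?_, ?_⟩
  · have hn := congrArg QuadraticAlgebra.norm hC
    rw [map_pow, map_mul, norm_quadraticOrder, norm_quadraticOrder, norm_quadraticOrder] at hn
    simp only at hn
    refine (Odd.strictMono_pow (by decide : Odd 5)).injective ?_
    refine mul_left_cancel₀ (show (1024 : ℤ) ≠ 0 by norm_num) ?_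
    rw [← h, hr]
    linear_combination -hn
  · have h1 : (⟨-52, 12⟩ : QuadraticOrder) * ⟨2, -1⟩ ^ 2 = 1024 := by
      ext <;> simp [pow_succ, QuadraticAlgebra.re_ofNat, QuadraticAlgebra.im_ofNat]
    have h2 : (⟨4 * X + 2 * V, 2 * V⟩ : QuadraticOrder) ^ 5 * ⟨2, -1⟩ ^ 2 = ⟨r, z⟩ * 1024 := by
      rw [hC, mul_assoc, h1]
    have h3 := congrArg QuadraticAlgebra.im h2
    simp only [pow_succ, pow_zero, one_mul, QuadraticAlgebra.re_mul, QuadraticAlgebra.im_mul,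
      QuadraticAlgebra.re_ofNat, QuadraticAlgebra.im_ofNat] at h3
    refine mul_left_cancel₀ (show (1024 : ℤ) ≠ 0 by norm_num) ?_
    rw [quinticForm]
    linear_combination -h3

lemma exists_eq_quinticForm {x y z : ℤ} (hx : Odd x) (hz : Odd z) (hy : 0 < y)
    (hzy : IsCoprime z y) (h : x ^ 2 + 55 * z ^ 2 = y ^ 5) :
    ∃ X V : ℤ, y = 4 * X ^ 2 + 6 * X * V + 16 * V ^ 2 ∧
      (quinticForm X V = z ∨ quinticForm X V = -z) := by
  obtain ⟨r, hr⟩ := (hx.sub_odd hz).two_dvd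
  by_cases hodd : Odd (r + z)
  · obtain ⟨X, V, h1, h2⟩ := exists_eq_quinticForm_of_odd hx hz hy hzy h (r := r) (by linarith) hodd
    exact ⟨X, V, h1, Or.inr (by linarith)⟩
  · have hodd' : Odd (r + z + -z) := (Int.not_odd_iff_even.1 hodd).add_odd hz.neg
    obtain ⟨X, V, h1, h2⟩ := exists_eq_quinticForm_of_odd hx hz.neg hy hzy.neg_left
      (by rw [neg_sq]; exact h) (r := r + z) (by linarith) hodd'
    exact ⟨X, V, h1, Or.inl (by linarith)⟩

end

theorem no_solutions_n_eq_5 (x y a b : ℕ) (hx : 0 < x) (hy : 0 < y)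
    (hgcd : Nat.gcd x y = 1) (ha : Odd a) (hb : Odd b) (hxodd : Odd x) :
    x ^ 2 + 5 ^ a * 11 ^ b ≠ y ^ 5 := by
  intro heq
  obtain ⟨m, rfl⟩ := ha
  obtain ⟨n, rfl⟩ := hb
  have hndvd {p : ℕ} (hp : p.Prime) (hd : p ∣ 5 ^ (2 * m + 1) * 11 ^ (2 * n + 1)) : ¬ p ∣ y := by
    intro hpy
    have hpx : p ∣ x := by
      refine hp.dvd_of_dvd_pow (n := 2) ((Nat.dvd_add_left hd).1 ?_)
      rw [heq]
      exact dvd_pow hpy (by norm_num)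
    exact hp.one_lt.ne' (Nat.dvd_one.1 (hgcd ▸ Nat.dvd_gcd hpx hpy))
  have h5 : ¬ 5 ∣ y :=
    hndvd Nat.prime_five ((dvd_pow_self 5 (by omega)).mul_right _)
  have h11 : ¬ 11 ∣ y :=
    hndvd (by norm_num) ((dvd_pow_self 11 (by omega)).mul_left _)
  have hzy : IsCoprime ((5 : ℤ) ^ m * 11 ^ n) y := by
    have : Nat.Coprime (5 ^ m * 11 ^ n) y :=
      (((Nat.Prime.coprime_iff_not_dvd Nat.prime_five).2 h5).pow_left m).mul_left
        (((Nat.Prime.coprime_iff_not_dvd (by norm_num)).2 h11).pow_left n)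
    exact_mod_cast Nat.isCoprime_iff_coprime.2 this
  have hz : Odd ((5 : ℤ) ^ m * 11 ^ n) :=
    (Odd.pow (by decide)).mul (Odd.pow (by decide))
  have hsq : (x : ℤ) ^ 2 + 55 * (5 ^ m * 11 ^ n) ^ 2 = (y : ℤ) ^ 5 := by
    have : (x : ℤ) ^ 2 + 5 ^ (2 * m + 1) * 11 ^ (2 * n + 1) = (y : ℤ) ^ 5 := by exact_mod_cast heq
    linear_combination this
  obtain ⟨X, V, hyXV, hform⟩ := exists_eq_quinticForm (by exact_mod_cast hxodd) hz
    (by exact_mod_cast hy) hzy hsq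
  obtain rfl : m = 0 := by
    by_contra hm
    have hd : (5 : ℤ) ∣ quinticForm X V := by
      have : (5 : ℤ) ∣ 5 ^ m * 11 ^ n := (dvd_pow_self 5 hm).mul_right _
      rcases hform with h | h <;> rw [h]
      · exact this
      · exact this.neg_right
    have hpow : (5 : ℤ) ∣ 3 * (X + 2 * V) ^ 5 := by
      refine (dvd_sub_right hd).1 ⟨2 * X ^ 4 * V - 24 * X ^ 3 * V ^ 2 - 112 * X ^ 2 * V ^ 3 -
        96 * X * V ^ 4 - 8 * V ^ 5, ?_⟩
      rw [quinticForm]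
      ring
    obtain ⟨k, hk⟩ : (5 : ℤ) ∣ X + 2 * V :=
      (by norm_num : Prime (5 : ℤ)).dvd_of_dvd_pow
        ((show IsCoprime (5 : ℤ) 3 by norm_num).dvd_of_dvd_mul_left hpow)
    refine h5 (Int.natCast_dvd_natCast.1 ⟨4 * k * (X + 2 * V) - 2 * X * V, ?_⟩)
    push_cast
    linear_combination hyXV + 4 * (X + 2 * V) * hk
  refine not_quinticForm_eq_pow (n := n) ?_ (by simpa using hform)
  rintro ⟨k, hk⟩
  refine h11 (Int.natCast_dvd_natCast.1 ⟨4 * k * (X - 2 * V) + 2 * X * V, ?_⟩)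
  push_cast
  linear_combination hyXV + 4 * (X - 2 * V) * hk
end
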